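/- arXiv:2312.13163 — 3 statements merged into one kernel-verified Lean document; each statement's English description precedes it below -/
import Mathlib

section
/- Let 1 < p < ∞, r > 0, β ∈ (0,1], and set p* := min(p,2). Assume ‖ψ_k‖_{L_p(Ω,μ)} ≤ B for all k ∈ ℤ^d, where μ is a probability measure on Ω. Then there exist constants c = c(r,β,p,d) and C = C(r,β,p,d) such that for any v ∈ ℕ there is J ∈ ℕ with 2^J ≤ v^c for which sup_{f ∈ A^r_β(Ψ)} σ_v(f, Ψ_J)_{L_p(Ω,μ)} ≤ C B v^{1/p* − 1/β − r/d}, where Ψ_J := {ψ_k : ‖k‖_∞ < 2^J}. Moreover, J can be chosen independently of the measure μ. -/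
open MeasureTheory Finset
open scoped ENNReal NNReal BigOperators

noncomputable section

attribute [local instance] Classical.propDecidable

namespace SamplingRecovery

/-- The `L_p(μ)` norm of a complex-valued function, `1 ≤ p < ∞`. -/
def lpNorm {X : Type*} [MeasurableSpace X] (μ : Measure X) (p : ℝ) (f : X → ℂ) : ℝ :=
  (∫ x, ‖f x‖ ^ p ∂μ) ^ (1 / p)

/-- The discrete `L_p(Ω_m, μ_m)` norm associated with sample points `ξ`. -/
def dNorm {X : Type*} {m : ℕ} (ξ : Fin m → X) (p : ℝ) (f : X → ℂ) : ℝ :=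
  ((m : ℝ)⁻¹ * ∑ j, ‖f (ξ j)‖ ^ p) ^ (1 / p)

/-- The uniform norm of a function. -/
def supNorm {X : Type*} (f : X → ℂ) : ℝ := ⨆ x, ‖f x‖

/-- `Σ_v(D)`: the set of all `v`-term linear combinations with respect to the system `g`. -/
def SigmaSet {X ι : Type*} (g : ι → X → ℂ) (v : ℕ) : Set (X → ℂ) :=
  {f | ∃ (B : Finset ι) (c : ι → ℂ), B.card ≤ v ∧ f = fun x => ∑ i ∈ B, c i * g i x}

/-- `Σ_v` restricted to indices in a finite set `T`. -/
def SigmaSetOn {X ι : Type*} (g : ι → X → ℂ) (T : Finset ι) (v : ℕ) : Set (X → ℂ) :=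
  {f | ∃ (B : Finset ι) (c : ι → ℂ), B ⊆ T ∧ B.card ≤ v ∧ f = fun x => ∑ i ∈ B, c i * g i x}

/-- `σ_v(f, D)_X`: the best `v`-term approximation error of `f` with respect to the
system `g`, measured in the (semi)norm `nrm`. -/
def sigmaErr {X ι : Type*} (nrm : (X → ℂ) → ℝ) (g : ι → X → ℂ) (v : ℕ) (f : X → ℂ) : ℝ :=
  sInf ((fun h => nrm (f - h)) '' SigmaSet g v)

/-- `σ_v(f, D)` with the system restricted to indices in `T`. -/
def sigmaErrOn {X ι : Type*} (nrm : (X → ℂ) → ℝ) (g : ι → X → ℂ) (T : Finset ι)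
    (v : ℕ) (f : X → ℂ) : ℝ :=
  sInf ((fun h => nrm (f - h)) '' SigmaSetOn g T v)

/-- The `(v,S)`-incoherence property with parameters `V > 0` and `r > 0` in the
(semi)norm `nrm`. -/
def Incoherent {X ι : Type*} (g : ι → X → ℂ) (v S : ℕ) (V r : ℝ)
    (nrm : (X → ℂ) → ℝ) : Prop :=
  ∀ (A B : Finset ι), A ⊆ B → A.card ≤ v → B.card ≤ S →
    ∀ c : ι → ℂ,
      ∑ i ∈ A, ‖c i‖ ≤ V * (A.card : ℝ) ^ r * nrm (fun x => ∑ i ∈ B, c i * g i x)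

/-- `(v,S)`-unconditionality with parameter `U` in the (semi)norm `nrm`. -/
def Unconditional {X ι : Type*} (g : ι → X → ℂ) (v S : ℕ) (U : ℝ)
    (nrm : (X → ℂ) → ℝ) : Prop :=
  ∀ (A B : Finset ι), A ⊆ B → A.card ≤ v → B.card ≤ S →
    ∀ c : ι → ℂ,
      nrm (fun x => ∑ i ∈ A, c i * g i x) ≤ U * nrm (fun x => ∑ i ∈ B, c i * g i x)

/-- The points `ξ` provide `L_p`-universal sampling discretization for the collection
`X_u(D_N)` of `u`-term subspaces generated by the system `g`. -/
def USD {X : Type*} [MeasurableSpace X] (μ : Measure X) (p : ℝ) {ι : Type*} {m : ℕ}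
    (g : ι → X → ℂ) (u : ℕ) (ξ : Fin m → X) : Prop :=
  ∀ f ∈ SigmaSet g u,
    (1 / 2 : ℝ) * (∫ x, ‖f x‖ ^ p ∂μ) ≤ (m : ℝ)⁻¹ * ∑ j, ‖f (ξ j)‖ ^ p ∧
    (m : ℝ)⁻¹ * ∑ j, ‖f (ξ j)‖ ^ p ≤ (3 / 2 : ℝ) * (∫ x, ‖f x‖ ^ p ∂μ)

/-- The measure `μ_ξ = (1/2) μ + (1/(2m)) ∑_j δ_{ξ^j}`. -/
def sampleMeasure {X : Type*} [MeasurableSpace X] (μ : Measure X) {m : ℕ}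
    (ξ : Fin m → X) : Measure X :=
  (1 / 2 : ℝ≥0∞) • μ + ((2 * m : ℝ≥0∞))⁻¹ • ∑ j, Measure.dirac (ξ j)

/-- A realization of the Weak Chebyshev Greedy Algorithm with weakness parameter `t`
applied to `f0` with respect to the system `g`, in the space with (semi)norm `nrm`:
`G k` is the approximant after `k` iterations (`f_k = f0 - G k` is the residual),
`φ k` the element of the system chosen at step `k+1`.  At each step a norming
functional `F` of the residual is used (a linear functional of norm `≤ 1` with
`F(f_k) = ‖f_k‖`), the new element `g (φ k)` satisfies the weakness condition
`|F(g (φ k))| ≥ t ⬝ sup_i |F(g i)|`, and `G (k+1)` is a best approximant to `f0`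
from the span of the chosen elements. -/
def IsWCGA {X ι : Type*} (g : ι → X → ℂ) (nrm : (X → ℂ) → ℝ) (t : ℝ)
    (f0 : X → ℂ) (φ : ℕ → ι) (G : ℕ → X → ℂ) : Prop :=
  G 0 = 0 ∧
  ∀ k : ℕ,
    (∃ F : (X → ℂ) →ₗ[ℂ] ℂ,
      (∀ h, ‖F h‖ ≤ nrm h) ∧
      F (f0 - G k) = ((nrm (f0 - G k) : ℝ) : ℂ) ∧
      ∀ i, t * ‖F (g i)‖ ≤ ‖F (g (φ k))‖) ∧
    G (k + 1) ∈ Submodule.span ℂ ((fun j => g (φ j)) '' Set.Iic k) ∧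
    ∀ h ∈ Submodule.span ℂ ((fun j => g (φ j)) '' Set.Iic k),
      nrm (f0 - G (k + 1)) ≤ nrm (f0 - h)

/-- The dyadic shell `{k ∈ ℤ^d : [2^{j-1}] ≤ ‖k‖_∞ < 2^j}` as a finite set. -/
def shell (d j : ℕ) : Finset (Fin d → ℤ) :=
  (Finset.Icc (fun _ => -(2 ^ j : ℤ)) fun _ => (2 ^ j : ℤ)).filter
    fun k => (if j = 0 then (0 : ℝ) else (2 : ℝ) ^ (j - 1)) ≤ ‖k‖ ∧ ‖k‖ < (2 : ℝ) ^ j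

/-- The discrete ball `{k ∈ ℤ^d : ‖k‖_∞ < n}` as a finite set. -/
def lball (d n : ℕ) : Finset (Fin d → ℤ) :=
  (Finset.Icc (fun _ => -(n : ℤ)) fun _ => (n : ℤ)).filter fun k => ‖k‖ < (n : ℝ)

/-- The class `A^r_β(Ψ)`: functions admitting an absolutely convergent expansion
`f = ∑_k a_k ψ_k` with `(∑_{[2^{j-1}] ≤ ‖k‖_∞ < 2^j} |a_k|^β)^{1/β} ≤ 2^{-rj}` for all `j`. -/
def ArClass {X : Type*} {d : ℕ} (ψ : (Fin d → ℤ) → X → ℂ) (β r : ℝ) : Set (X → ℂ) :=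
  {f | ∃ a : (Fin d → ℤ) → ℂ,
    Summable (fun k => ‖a k‖) ∧
    (∀ x, HasSum (fun k => a k * ψ k x) (f x)) ∧
    ∀ j : ℕ, (∑ k ∈ shell d j, ‖a k‖ ^ β) ^ (1 / β) ≤ (2 : ℝ) ^ (-(r * j))}

/-- `ϱ_m^o(F, X)`: the optimal sampling recovery error of a class `F` from `m` point
values, measured in the (semi)norm `nrm`; the recovery maps `M` are arbitrary. -/
def optRecovery {X : Type*} (F : Set (X → ℂ)) (m : ℕ) (nrm : (X → ℂ) → ℝ) : ℝ :=
  ⨅ (ξ : Fin m → X), ⨅ (M : (Fin m → ℂ) → X → ℂ),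
    ⨆ f ∈ F, nrm (f - M fun j => f (ξ j))

/-- The Kolmogorov width `d_n(F, E)` of a set `F` in a space with (semi)norm `nrm`. -/
def kWidth {E : Type*} [AddCommGroup E] [Module ℂ E] (nrm : E → ℝ) (F : Set E)
    (n : ℕ) : ℝ :=
  ⨅ u : Fin n → E, ⨆ f ∈ F, ⨅ c : Fin n → ℂ, nrm (f - ∑ i, c i • u i)

/-- Normalized Lebesgue measure on the cube `[0, 2π)^d`, representing `𝕋^d`. -/
def torusMeasure (d : ℕ) : Measure (Fin d → ℝ) :=
  (ENNReal.ofReal ((2 * Real.pi) ^ d))⁻¹ •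
    volume.restrict (Set.univ.pi fun _ => Set.Ico (0 : ℝ) (2 * Real.pi))

/-- The trigonometric monomial `e^{i(k,x)}` on `𝕋^d`. -/
def trig {d : ℕ} (k : Fin d → ℤ) (x : Fin d → ℝ) : ℂ :=
  Complex.exp (Complex.I * ((∑ j, (k j : ℝ) * x j : ℝ) : ℂ))

end SamplingRecovery

open SamplingRecovery

lemma aux_pow_sub (n : ℕ) (t : ℝ) (h1 : 1 ≤ t) (h4 : t ≤ 4) :
    t ^ n - 1 ≤ n * 4 ^ n * (t - 1) := by
  induction n with
  | zero => simp
  | succ n ih =>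
    have h0 : (0:ℝ) ≤ n * 4 ^ n * (t - 1) := by
      have : 0 ≤ t - 1 := by linarith
      positivity
    have h2 : t * (t ^ n - 1) ≤ 4 * (n * 4 ^ n * (t - 1)) := by
      have h3 : 0 ≤ t ^ n - 1 := by
        have := one_le_pow₀ h1 (n := n)
        linarith
      nlinarith
    have h5 : (1:ℝ) ≤ 4 ^ (n+1) := one_le_pow₀ (by norm_num)
    have h6 : t ^ (n+1) - 1 = t * (t^n - 1) + (t - 1) := by ring
    rw [h6]
    push_cast
    have : ((n:ℝ) + 1) * 4 ^ (n+1) * (t-1) = 4 * (n * 4 ^ n * (t - 1)) + 4^(n+1) * (t-1) := by ring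
    rw [this]
    nlinarith

lemma aux_real (e : ℝ) (he : 0 < e) : ∃ D : ℝ, 0 ≤ D ∧ ∀ t : ℝ, 0 ≤ t → t ≤ 4 →
    t ^ e ≤ 1 + e * (t - 1) + D * (t - 1) ^ 2 := by
  rcases le_total e 1 with h1 | h1
  · refine ⟨0, le_rfl, fun t ht _ => ?_⟩
    have := rpow_one_add_le_one_add_mul_self (s := t - 1) (by linarith) he.le h1
    simpa using this
  · set n := ⌈e - 1⌉₊ with hn
    have hn' : e - 1 ≤ n := Nat.le_ceil _
    refine ⟨e * (n * 4 ^ n) + e, by positivity, fun t ht ht4 => ?_⟩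
    rcases ht.eq_or_lt with rfl | ht0
    · rw [Real.zero_rpow he.ne']
      have : 0 ≤ e * (n * 4 ^ n) := by positivity
      nlinarith
    have htan : t ^ e ≤ 1 + e * t ^ (e - 1) * (t - 1) := by
      have h := one_add_mul_self_le_rpow_one_add (s := t⁻¹ - 1)
        (by have : 0 < t⁻¹ := by positivity
            linarith) h1
      have h2 := mul_le_mul_of_nonneg_left h (Real.rpow_nonneg ht e)
      have h3 : t ^ e * (1 + (t⁻¹ - 1)) ^ e = 1 := by
        rw [← Real.mul_rpow ht (by simp; linarith)]
        have : t * (1 + (t⁻¹ - 1)) = 1 := by field_simp; ring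
        rw [this, Real.one_rpow]
      rw [h3] at h2
      have h4 : t ^ e = t ^ (e - 1) * t := by
        rw [← Real.rpow_add_one ht0.ne']; ring_nf
      have h5 : t ^ e * (1 + e * (t⁻¹ - 1)) = t ^ e + e * t ^ (e - 1) * (1 - t) := by
        rw [h4]; field_simp
      rw [h5] at h2
      linarith
    have hkey : (t - 1) * (t ^ (e - 1) - 1) ≤ (n * 4 ^ n) * (t - 1) ^ 2 := by
      rcases le_total 1 t with h | h
      · have a1 : t ^ (e - 1) ≤ t ^ n := by
          rw [← Real.rpow_natCast]
          exact Real.rpow_le_rpow_of_exponent_le h hn'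
        have a2 := aux_pow_sub n t h ht4
        have : t ^ (e-1) - 1 ≤ n * 4 ^ n * (t - 1) := by linarith
        nlinarith
      · have a1 : t ^ n ≤ t ^ (e - 1) := by
          rw [← Real.rpow_natCast]
          exact Real.rpow_le_rpow_of_exponent_ge ht0 h hn'
        have a2 := one_add_mul_le_pow (a := t - 1) (by linarith) n
        simp only [add_sub_cancel] at a2
        have a3 : (n:ℝ) ≤ n * 4 ^ n := by
          have : (1:ℝ) ≤ 4 ^ n := one_le_pow₀ (by norm_num)
          have hn0 : (0:ℝ) ≤ n := by positivity
          nlinarith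
        have : 1 - t ^ (e-1) ≤ n * (1 - t) := by linarith
        have : 1 - t ^ (e-1) ≤ (n * 4 ^ n) * (1 - t) := by nlinarith
        nlinarith
    have := mul_le_mul_of_nonneg_left hkey he.le
    nlinarith [sq_nonneg (t - 1)]

lemma aux_scalar (p : ℝ) (hp : 1 < p) : ∃ C : ℝ, 1 ≤ C ∧ ∀ x : ℂ, ∃ z : ℂ, ∀ y : ℂ,
    ‖x + y‖ ^ p ≤ ‖x‖ ^ p + (z * y).re +
      C * (‖x‖ ^ (p - min p 2) * ‖y‖ ^ (min p 2) + ‖y‖ ^ p) := by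
  obtain ⟨D, hD0, hD⟩ := aux_real (p / 2) (by linarith)
  have h2p : (0:ℝ) < 2 ^ p := by positivity
  refine ⟨1 + 2 ^ p + p + (p / 2 + 9 * D), by linarith, fun x => ?_⟩
  set C := 1 + 2 ^ p + p + (p / 2 + 9 * D) with hC
  by_cases hx : x = 0
  · refine ⟨0, fun y => ?_⟩
    subst hx
    have hy : 0 ≤ ‖y‖ ^ p := by positivity
    have : 0 ≤ ‖(0:ℂ)‖ ^ (p - min p 2) * ‖y‖ ^ (min p 2) := by positivity
    have h0 : ‖(0:ℂ)‖ ^ p = 0 := by rw [norm_zero, Real.zero_rpow (by linarith)]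
    rw [h0]
    simp only [zero_mul, Complex.zero_re, zero_add]
    have hC1 : 1 ≤ C := by linarith
    nlinarith
  have hx0 : 0 < ‖x‖ := norm_pos_iff.mpr hx
  refine ⟨((p * ‖x‖ ^ (p - 2) : ℝ) : ℂ) * (starRingEnd ℂ x), fun y => ?_⟩
  have hre : (((p * ‖x‖ ^ (p - 2) : ℝ) : ℂ) * (starRingEnd ℂ x) * y).re
      = p * ‖x‖ ^ (p - 2) * ((starRingEnd ℂ x) * y).re := by
    rw [mul_assoc, Complex.re_ofReal_mul]
  rw [hre]
  set ρ := ((starRingEnd ℂ x) * y).re with hρ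
  have hρabs : |ρ| ≤ ‖x‖ * ‖y‖ := by
    have := Complex.abs_re_le_norm ((starRingEnd ℂ x) * y)
    rwa [norm_mul, RCLike.norm_conj] at this
  have hsq : ‖x + y‖ ^ 2 = ‖x‖ ^ 2 + 2 * ρ + ‖y‖ ^ 2 := by
    rw [← Complex.normSq_eq_norm_sq, ← Complex.normSq_eq_norm_sq, ← Complex.normSq_eq_norm_sq,
      Complex.normSq_add, hρ]
    simp; ring
  have hpx : ‖x‖ ^ p = ‖x‖ ^ (p - 2) * ‖x‖ ^ 2 := by
    rw [← Real.rpow_natCast, ← Real.rpow_add hx0]; norm_num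
  have hxp2 : 0 < ‖x‖ ^ (p - 2) := by positivity
  have hyp : 0 ≤ ‖y‖ ^ p := by positivity
  have hq : 0 ≤ ‖x‖ ^ (p - min p 2) * ‖y‖ ^ (min p 2) := by positivity
  have hxp : 0 ≤ ‖x‖ ^ p := by positivity
  have hab := abs_le.mp hρabs
  rcases le_or_gt ‖x‖ ‖y‖ with hxy | hxy
  · have hy0 : 0 < ‖y‖ := hx0.trans_le hxy
    have a1 : ‖x + y‖ ^ p ≤ 2 ^ p * ‖y‖ ^ p := by
      rw [← Real.mul_rpow (by norm_num) (norm_nonneg _)]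
      apply Real.rpow_le_rpow (norm_nonneg _) _ (by linarith)
      have := norm_add_le x y
      linarith
    have a2 : ‖x‖ ^ (p - 2) * (‖x‖ * ‖y‖) ≤ ‖y‖ ^ p := by
      have e1 : ‖x‖ ^ (p - 2) * (‖x‖ * ‖y‖) = ‖x‖ ^ (p - 1) * ‖y‖ := by
        rw [← mul_assoc, ← Real.rpow_add_one hx0.ne']; ring_nf
      have e2 : ‖y‖ ^ p = ‖y‖ ^ (p - 1) * ‖y‖ := by
        rw [← Real.rpow_add_one hy0.ne']; ring_nf
      rw [e1, e2]
      gcongr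
    have a3 : -(‖y‖ ^ p) ≤ ‖x‖ ^ (p - 2) * ρ := by
      have := mul_le_mul_of_nonneg_left hab.1 hxp2.le
      linarith
    have a4 : -(p * ‖y‖ ^ p) ≤ p * ‖x‖ ^ (p - 2) * ρ := by
      have := mul_le_mul_of_nonneg_left a3 (by linarith : 0 ≤ p)
      linarith
    have a5 : (2 ^ p + p) * ‖y‖ ^ p ≤ C * (‖x‖ ^ (p - min p 2) * ‖y‖ ^ (min p 2) + ‖y‖ ^ p) := by
      apply mul_le_mul _ _ hyp (by linarith)
      · linarith
      · linarith
    linarith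
  · set t := ‖x + y‖ ^ 2 / ‖x‖ ^ 2 with ht
    have ht0 : 0 ≤ t := by positivity
    have ht4 : t ≤ 4 := by
      rw [ht, div_le_iff₀ (by positivity)]
      have := norm_add_le x y
      nlinarith [norm_nonneg (x + y)]
    have h := hD t ht0 ht4
    have b1 : ‖x + y‖ ^ p = ‖x‖ ^ p * t ^ (p / 2) := by
      rw [ht, Real.div_rpow (by positivity) (by positivity), ← Real.rpow_natCast,
        ← Real.rpow_natCast, ← Real.rpow_mul (norm_nonneg _), ← Real.rpow_mul (norm_nonneg _)]
      have : ((2:ℕ):ℝ) * (p / 2) = p := by push_cast; ring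
      rw [this]
      field_simp
    have b2 : ‖x‖ ^ 2 * (t - 1) = 2 * ρ + ‖y‖ ^ 2 := by
      rw [ht]; field_simp; linarith
    have b3 : ‖x‖ ^ 2 * (t - 1) ^ 2 ≤ 9 * ‖y‖ ^ 2 := by
      have c1 : |2 * ρ + ‖y‖ ^ 2| ≤ 3 * (‖x‖ * ‖y‖) := by
        rw [abs_le]; constructor <;> nlinarith [norm_nonneg y]
      have c2 : (2 * ρ + ‖y‖ ^ 2) ^ 2 ≤ (3 * (‖x‖ * ‖y‖)) ^ 2 := by
        rw [← sq_abs]; gcongr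
      rw [← b2] at c2
      have : ‖x‖ ^ 2 * (‖x‖ ^ 2 * (t - 1) ^ 2) ≤ ‖x‖ ^ 2 * (9 * ‖y‖ ^ 2) := by nlinarith
      exact le_of_mul_le_mul_left this (by positivity)
    have b4 : ‖x‖ ^ (p - 2) * ‖y‖ ^ 2 ≤ ‖x‖ ^ (p - min p 2) * ‖y‖ ^ (min p 2) := by
      rcases le_total p 2 with h | h
      · rw [min_eq_left h, sub_self, Real.rpow_zero, one_mul]
        rcases (norm_nonneg y).eq_or_lt with h0 | h0
        · rw [← h0]; simp; positivity
        · have e2 : ‖y‖ ^ p = ‖y‖ ^ (p - 2) * ‖y‖ ^ 2 := by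
            rw [← Real.rpow_natCast, ← Real.rpow_add h0]; norm_num
          rw [e2]
          gcongr ?_ * _
          exact Real.rpow_le_rpow_of_nonpos h0 hxy.le (by linarith)
      · rw [min_eq_right h]
        simp
    rw [b1]
    calc ‖x‖ ^ p * t ^ (p / 2) ≤ ‖x‖ ^ p * (1 + p / 2 * (t - 1) + D * (t - 1) ^ 2) := by gcongr
      _ = ‖x‖ ^ p + ‖x‖ ^ (p-2) * (p / 2 * (‖x‖ ^ 2 * (t - 1)) + D * (‖x‖ ^ 2 * (t - 1) ^ 2)) := by
          rw [hpx]; ring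
      _ ≤ ‖x‖ ^ p + ‖x‖ ^ (p-2) * (p / 2 * (2 * ρ + ‖y‖ ^ 2) + D * (9 * ‖y‖ ^ 2)) := by
          rw [b2]; gcongr
      _ = ‖x‖ ^ p + p * ‖x‖ ^ (p-2) * ρ + (p / 2 + 9 * D) * (‖x‖ ^ (p-2) * ‖y‖ ^ 2) := by ring
      _ ≤ ‖x‖ ^ p + p * ‖x‖ ^ (p-2) * ρ + C * (‖x‖ ^ (p - min p 2) * ‖y‖ ^ (min p 2) + ‖y‖ ^ p) := by
          gcongr
          · linarith
          · linarith

lemma aux_integrable {X : Type} [TopologicalSpace X] [CompactSpace X] [MeasurableSpace X]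
    [BorelSpace X] (μ : Measure X) [IsProbabilityMeasure μ] (g : X → ℝ) (hg : Continuous g) :
    Integrable g μ :=
  hg.integrable_of_hasCompactSupport (HasCompactSupport.of_compactSpace g)

lemma aux_holder {X : Type} [TopologicalSpace X] [CompactSpace X] [MeasurableSpace X]
    [BorelSpace X] (μ : Measure X) [IsProbabilityMeasure μ] (p q : ℝ) (hp : 0 < p) (hq : 0 < q)
    (hqp : q ≤ p) (g h : X → ℂ) (hg : Continuous g) (hh : Continuous h) (U V : ℝ) (hU : 0 < U)
    (hV : 0 < V) (hgU : ∫ x, ‖g x‖ ^ p ∂μ ≤ U ^ p) (hhV : ∫ x, ‖h x‖ ^ p ∂μ ≤ V ^ p) :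
    ∫ x, ‖g x‖ ^ (p - q) * ‖h x‖ ^ q ∂μ ≤ U ^ (p - q) * V ^ q := by
  have hpq : 0 ≤ p - q := by linarith
  have key : ∀ x, ‖g x‖ ^ (p - q) * ‖h x‖ ^ q ≤ U ^ (p - q) * V ^ q *
      (((p - q) / p) * (‖g x‖ ^ p / U ^ p) + (q / p) * (‖h x‖ ^ p / V ^ p)) := by
    intro x
    have h1 := Real.geom_mean_le_arith_mean2_weighted (w₁ := (p - q) / p) (w₂ := q / p)
      (p₁ := ‖g x‖ ^ p / U ^ p) (p₂ := ‖h x‖ ^ p / V ^ p) (by positivity) (by positivity)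
      (by positivity) (by positivity) (by field_simp; ring)
    have e1 : (‖g x‖ ^ p / U ^ p) ^ ((p - q) / p) = ‖g x‖ ^ (p - q) / U ^ (p - q) := by
      rw [← Real.div_rpow (norm_nonneg _) hU.le, ← Real.rpow_mul (by positivity),
        mul_div_cancel₀ _ hp.ne', Real.div_rpow (norm_nonneg _) hU.le]
    have e2 : (‖h x‖ ^ p / V ^ p) ^ (q / p) = ‖h x‖ ^ q / V ^ q := by
      rw [← Real.div_rpow (norm_nonneg _) hV.le, ← Real.rpow_mul (by positivity),
        mul_div_cancel₀ _ hp.ne', Real.div_rpow (norm_nonneg _) hV.le]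
    rw [e1, e2] at h1
    have hUp : 0 < U ^ (p - q) := by positivity
    have hVp : 0 < V ^ q := by positivity
    calc ‖g x‖ ^ (p - q) * ‖h x‖ ^ q = U ^ (p - q) * V ^ q *
        (‖g x‖ ^ (p - q) / U ^ (p - q) * (‖h x‖ ^ q / V ^ q)) := by field_simp
      _ ≤ _ := by gcongr
  have cg : Continuous fun x => ‖g x‖ ^ p := hg.norm.rpow_const fun _ => Or.inr hp.le
  have ch : Continuous fun x => ‖h x‖ ^ p := hh.norm.rpow_const fun _ => Or.inr hp.le
  have cg' : Continuous fun x => ‖g x‖ ^ (p - q) := hg.norm.rpow_const fun _ => Or.inr hpq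
  have ch' : Continuous fun x => ‖h x‖ ^ q := hh.norm.rpow_const fun _ => Or.inr hq.le
  calc ∫ x, ‖g x‖ ^ (p - q) * ‖h x‖ ^ q ∂μ ≤ ∫ x, U ^ (p - q) * V ^ q *
      (((p - q) / p) * (‖g x‖ ^ p / U ^ p) + (q / p) * (‖h x‖ ^ p / V ^ p)) ∂μ := by
        apply integral_mono (aux_integrable μ _ (by fun_prop)) (aux_integrable μ _ (by fun_prop)) key
    _ = U ^ (p - q) * V ^ q * (((p - q) / p) * ((∫ x, ‖g x‖ ^ p ∂μ) / U ^ p)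
          + (q / p) * ((∫ x, ‖h x‖ ^ p ∂μ) / V ^ p)) := by
        rw [integral_const_mul, integral_add (aux_integrable μ _ (by fun_prop))
          (aux_integrable μ _ (by fun_prop)), integral_const_mul, integral_const_mul,
          integral_div, integral_div]
    _ ≤ U ^ (p - q) * V ^ q * (((p - q) / p) * 1 + (q / p) * 1) := by
        gcongr
        · rw [div_le_one (by positivity)]; exact hgU
        · rw [div_le_one (by positivity)]; exact hhV
    _ = U ^ (p - q) * V ^ q := by
        have : ((p - q) / p) * 1 + (q / p) * 1 = 1 := by field_simp; ring
        rw [this, mul_one]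

lemma aux_maurey (p : ℝ) (hp : 1 < p) : ∃ K : ℝ, 1 ≤ K ∧
    ∀ (X : Type) [TopologicalSpace X] [CompactSpace X] [MeasurableSpace X]
    [BorelSpace X] (μ : Measure X) [IsProbabilityMeasure μ] (ι : Type) [DecidableEq ι]
    (s : Finset ι) (w : ι → ℝ)
    (y : ι → X → ℂ) (H : ℝ), (∀ k, Continuous (y k)) → (∀ k ∈ s, 0 ≤ w k) → ∑ k ∈ s, w k = 1 →
    (∀ x, ∑ k ∈ s, (w k : ℂ) * y k x = 0) → 0 < H → (∀ k ∈ s, ∫ x, ‖y k x‖ ^ p ∂μ ≤ H ^ p) →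
    ∀ n : ℕ, ∃ c : ι → ℕ, ∑ k ∈ s, c k = n ∧
      ∫ x, ‖∑ k ∈ s, (c k : ℂ) * y k x‖ ^ p ∂μ ≤ ((K * n) ^ (1 / min p 2) * H) ^ p := by
  obtain ⟨C, hC1, hC⟩ := aux_scalar p hp
  refine ⟨2 * C, by linarith, ?_⟩
  intro X _ _ _ _ μ _ ι _ s w y H hy hw hw1 hmean hH hyH n
  set q := min p 2 with hqdef
  have hq : 0 < q := by rw [hqdef]; exact lt_min (by linarith) (by norm_num)
  have hqp : q ≤ p := min_le_left _ _
  have hp0 : 0 < p := by linarith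
  induction n with
  | zero =>
    refine ⟨fun _ => 0, by simp, ?_⟩
    simp [Real.zero_rpow hp0.ne', Real.zero_rpow (inv_pos.mpr hq).ne']
  | succ n ih =>
    obtain ⟨c, hcn, hc⟩ := ih
    -- it suffices to find a good index
    suffices hs : ∃ i ∈ s, ∫ x, ‖(∑ k ∈ s, (c k : ℂ) * y k x) + y i x‖ ^ p ∂μ ≤
        ((2 * C * (n + 1 : ℕ)) ^ (1 / q) * H) ^ p by
      obtain ⟨i, hi, h⟩ := hs
      refine ⟨fun k => c k + if k = i then 1 else 0, ?_, ?_⟩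
      · rw [Finset.sum_add_distrib, hcn]; simp [hi]
      · convert h using 5 with x
        push_cast
        simp only [add_mul, Finset.sum_add_distrib]
        simp [hi]
    rcases Nat.eq_zero_or_pos n with hn | hn
    · subst hn
      obtain ⟨i, hi⟩ : s.Nonempty := by
        rw [Finset.nonempty_iff_ne_empty]; rintro rfl; simp at hw1
      refine ⟨i, hi, ?_⟩
      have hc0 : ∀ k ∈ s, c k = 0 := by simpa using hcn
      have : ∀ x, ∑ k ∈ s, (c k : ℂ) * y k x = 0 := fun x =>
        Finset.sum_eq_zero fun k hk => by simp [hc0 k hk]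
      simp only [this, zero_add]
      refine (hyH i hi).trans ?_
      gcongr
      have : (1:ℝ) ≤ (2 * C * (1:ℕ)) ^ (1 / q) := by
        apply Real.one_le_rpow
        · push_cast; linarith
        · positivity
      simp only [Nat.cast_one] at this ⊢
      nlinarith
    set G : X → ℂ := fun x => ∑ k ∈ s, (c k : ℂ) * y k x with hG
    have hGc : Continuous G := by fun_prop
    set M : ℝ := 2 * C * n with hM
    have hn1 : (1:ℝ) ≤ n := by exact_mod_cast hn
    have hM1 : 1 ≤ M := by rw [hM]; nlinarith
    set U : ℝ := M ^ (1 / q) * H with hU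
    have hU0 : 0 < U := by positivity
    have hol : ∀ k ∈ s, ∫ x, ‖G x‖ ^ (p - q) * ‖y k x‖ ^ q ∂μ ≤ U ^ (p - q) * H ^ q := fun k hk =>
      aux_holder μ p q hp0 hq hqp G (y k) hGc (hy k) U H hU0 hH hc (hyH k hk)
    have cG : Continuous fun x => ‖G x‖ ^ p := hGc.norm.rpow_const fun _ => Or.inr hp0.le
    have cG' : Continuous fun x => ‖G x‖ ^ (p - q) :=
      hGc.norm.rpow_const fun _ => Or.inr (by linarith)
    have cy : ∀ k, Continuous fun x => ‖y k x‖ ^ p := fun k =>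
      (hy k).norm.rpow_const fun _ => Or.inr hp0.le
    have cy' : ∀ k, Continuous fun x => ‖y k x‖ ^ q := fun k =>
      (hy k).norm.rpow_const fun _ => Or.inr hq.le
    have cs : ∀ k, Continuous fun x => ‖G x + y k x‖ ^ p := fun k =>
      (hGc.add (hy k)).norm.rpow_const fun _ => Or.inr hp0.le
    set T := U ^ p + C * (U ^ (p - q) * H ^ q + H ^ p) with hT
    have hTle : T ≤ ((2 * C * (n + 1 : ℕ)) ^ (1 / q) * H) ^ p := by
      have e1 : ∀ N : ℝ, 0 < N → (N ^ (1 / q) * H) ^ p = N ^ (p / q - 1) * N * H ^ p := by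
        intro N hN
        rw [Real.mul_rpow (by positivity) hH.le, ← Real.rpow_mul hN.le,
          ← Real.rpow_add_one hN.ne']
        congr 2; ring
      have e2 : U ^ (p - q) * H ^ q = M ^ (p / q - 1) * H ^ p := by
        rw [hU, Real.mul_rpow (by positivity) hH.le, ← Real.rpow_mul (by linarith), mul_assoc,
          ← Real.rpow_add hH]
        congr 2
        · field_simp
        · ring
      have hpq1 : 0 ≤ p / q - 1 := by
        have : 1 ≤ p / q := by rw [le_div_iff₀ hq]; linarith
        linarith
      have hMp : 1 ≤ M ^ (p / q - 1) := Real.one_le_rpow hM1 hpq1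
      have hHp : 0 < H ^ p := by positivity
      have hM2 : 2 * C * (n + 1 : ℕ) = M + 2 * C := by rw [hM]; push_cast; ring
      rw [hT, hU, e1 M (by linarith), ← hU, e2, hM2, e1 _ (by linarith)]
      calc M ^ (p / q - 1) * M * H ^ p + C * (M ^ (p / q - 1) * H ^ p + H ^ p)
          ≤ M ^ (p / q - 1) * M * H ^ p + C * (M ^ (p / q - 1) * H ^ p + M ^ (p / q - 1) * H ^ p) := by
            gcongr
            nlinarith
        _ = M ^ (p / q - 1) * (M + 2 * C) * H ^ p := by ring
        _ ≤ (M + 2 * C) ^ (p / q - 1) * (M + 2 * C) * H ^ p := by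
            gcongr
            linarith
    have hsum : ∑ k ∈ s, w k * ∫ x, ‖G x + y k x‖ ^ p ∂μ ≤ T := by
      have hpt : ∀ x, ∑ k ∈ s, w k * ‖G x + y k x‖ ^ p ≤
          ‖G x‖ ^ p + ∑ k ∈ s, w k * (C * (‖G x‖ ^ (p - q) * ‖y k x‖ ^ q + ‖y k x‖ ^ p)) := by
        intro x
        obtain ⟨z, hz⟩ := hC (G x)
        have h0 : ∑ k ∈ s, w k * (z * y k x).re = 0 := by
          have : ∑ k ∈ s, w k * (z * y k x).re = (z * ∑ k ∈ s, (w k : ℂ) * y k x).re := by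
            rw [Finset.mul_sum, Complex.re_sum]
            refine Finset.sum_congr rfl fun k _ => ?_
            rw [← Complex.re_ofReal_mul]; congr 1; ring
          rw [this, hmean]; simp
        calc ∑ k ∈ s, w k * ‖G x + y k x‖ ^ p ≤ ∑ k ∈ s, w k * (‖G x‖ ^ p + (z * y k x).re +
              C * (‖G x‖ ^ (p - q) * ‖y k x‖ ^ q + ‖y k x‖ ^ p)) :=
              Finset.sum_le_sum fun k hk => mul_le_mul_of_nonneg_left (hz _) (hw k hk)
          _ = _ := by
              simp only [mul_add, Finset.sum_add_distrib]
              rw [h0, ← Finset.sum_mul, hw1]; ring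
      calc ∑ k ∈ s, w k * ∫ x, ‖G x + y k x‖ ^ p ∂μ
          = ∫ x, ∑ k ∈ s, w k * ‖G x + y k x‖ ^ p ∂μ := by
            rw [integral_finsetSum _ fun k _ => aux_integrable μ _ (by fun_prop)]
            simp only [integral_const_mul]
        _ ≤ ∫ x, (‖G x‖ ^ p +
              ∑ k ∈ s, w k * (C * (‖G x‖ ^ (p - q) * ‖y k x‖ ^ q + ‖y k x‖ ^ p))) ∂μ :=
            integral_mono (aux_integrable μ _ (by fun_prop)) (aux_integrable μ _ (by fun_prop)) hpt
        _ = (∫ x, ‖G x‖ ^ p ∂μ) + ∑ k ∈ s, w k * (C * ((∫ x, ‖G x‖ ^ (p - q) * ‖y k x‖ ^ q ∂μ) +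
              ∫ x, ‖y k x‖ ^ p ∂μ)) := by
            rw [integral_add (aux_integrable μ _ (by fun_prop)) (aux_integrable μ _ (by fun_prop)),
              integral_finsetSum _ fun k _ => aux_integrable μ _ (by fun_prop)]
            simp only [integral_const_mul]
            congr 1
            refine Finset.sum_congr rfl fun k _ => ?_
            rw [integral_add (aux_integrable μ _ (by fun_prop)) (aux_integrable μ _ (by fun_prop))]
        _ ≤ U ^ p + ∑ k ∈ s, w k * (C * (U ^ (p - q) * H ^ q + H ^ p)) := by
            apply add_le_add hc
            refine Finset.sum_le_sum fun k hk => mul_le_mul_of_nonneg_left ?_ (hw k hk)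
            have := hol k hk
            have := hyH k hk
            gcongr
        _ = T := by rw [← Finset.sum_mul, hw1, one_mul]
    by_contra hcon
    push Not at hcon
    obtain ⟨i, hi, hi0⟩ := Finset.exists_ne_zero_of_sum_ne_zero
      (by rw [hw1]; exact one_ne_zero : ∑ k ∈ s, w k ≠ 0)
    have hlt : ∑ k ∈ s, w k * T < ∑ k ∈ s, w k * ∫ x, ‖G x + y k x‖ ^ p ∂μ := by
      apply Finset.sum_lt_sum
      · intro k hk
        exact mul_le_mul_of_nonneg_left (hTle.trans (hcon k hk).le) (hw k hk)
      · exact ⟨i, hi, mul_lt_mul_of_pos_left (hTle.trans_lt (hcon i hi))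
          (lt_of_le_of_ne (hw i hi) (Ne.symm hi0))⟩
    rw [← Finset.sum_mul, hw1, one_mul] at hlt
    linarith

set_option linter.unusedSectionVars false

section norms
variable {X : Type} [TopologicalSpace X] [CompactSpace X] [MeasurableSpace X]
    [BorelSpace X] (μ : Measure X) [IsProbabilityMeasure μ] (p : ℝ)

lemma aux_nonneg (g : X → ℂ) : 0 ≤ SamplingRecovery.lpNorm μ p g :=
  Real.rpow_nonneg (integral_nonneg fun _ => Real.rpow_nonneg (norm_nonneg _) _) _

lemma aux_memLp (g : X → ℂ) (hg : Continuous g) : MemLp g (ENNReal.ofReal p) μ := by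
  obtain ⟨M, hM⟩ := isCompact_univ.exists_bound_of_continuousOn hg.continuousOn
  exact MemLp.of_bound hg.measurable.aestronglyMeasurable M (ae_of_all _ fun x => hM x trivial)

lemma aux_eLp (hp : 1 < p) (g : X → ℂ) (hg : MemLp g (ENNReal.ofReal p) μ) :
    eLpNorm g (ENNReal.ofReal p) μ = ENNReal.ofReal (SamplingRecovery.lpNorm μ p g) := by
  rw [MemLp.eLpNorm_eq_integral_rpow_norm (by simp; linarith) (by simp) hg, SamplingRecovery.lpNorm,
    ENNReal.toReal_ofReal (by linarith), one_div]

lemma aux_add (hp : 1 < p) (g h : X → ℂ) (hg : Continuous g) (hh : Continuous h) :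
    SamplingRecovery.lpNorm μ p (fun x => g x + h x) ≤
      SamplingRecovery.lpNorm μ p g + SamplingRecovery.lpNorm μ p h := by
  have h1 := eLpNorm_add_le (μ := μ) (p := ENNReal.ofReal p) (f := g) (g := h)
    hg.measurable.aestronglyMeasurable hh.measurable.aestronglyMeasurable
    (by simpa using hp.le)
  rw [aux_eLp μ p hp g (aux_memLp μ p g hg), aux_eLp μ p hp h (aux_memLp μ p h hh),
    aux_eLp μ p hp _ (aux_memLp μ p _ (hg.add hh)), ← ENNReal.ofReal_add (aux_nonneg _ _ _)
    (aux_nonneg _ _ _), ENNReal.ofReal_le_ofReal_iff (add_nonneg (aux_nonneg _ _ _)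
    (aux_nonneg _ _ _))] at h1
  exact h1

lemma aux_smul (hp : 1 < p) (g : X → ℂ) (a : ℂ) :
    SamplingRecovery.lpNorm μ p (fun x => a * g x) = ‖a‖ * SamplingRecovery.lpNorm μ p g := by
  unfold SamplingRecovery.lpNorm
  simp only [norm_mul, Real.mul_rpow (norm_nonneg _) (norm_nonneg _)]
  rw [integral_const_mul, Real.mul_rpow (by positivity)
    (integral_nonneg fun _ => Real.rpow_nonneg (norm_nonneg _) _),
    ← Real.rpow_mul (norm_nonneg _), mul_one_div_cancel (by linarith), Real.rpow_one]

lemma aux_sum (hp : 1 < p) {ι : Type} [DecidableEq ι] (s : Finset ι) (a : ι → ℂ) (ψ : ι → X → ℂ)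
    (hψ : ∀ k, Continuous (ψ k)) (B : ℝ) (hB : ∀ k, SamplingRecovery.lpNorm μ p (ψ k) ≤ B) :
    SamplingRecovery.lpNorm μ p (fun x => ∑ k ∈ s, a k * ψ k x) ≤ (∑ k ∈ s, ‖a k‖) * B := by
  induction s using Finset.induction_on with
  | empty =>
    simp only [Finset.sum_empty, zero_mul, SamplingRecovery.lpNorm, norm_zero]
    rw [Real.zero_rpow (by linarith)]
    simp only [integral_zero]
    rw [Real.zero_rpow (by simp; linarith)]
  | insert i s hi ih =>
    simp only [Finset.sum_insert hi]
    refine (aux_add μ p hp _ _ (by fun_prop) (by fun_prop)).trans ?_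
    rw [aux_smul μ p hp, add_mul]
    gcongr
    exact hB i

lemma aux_int_le (hp : 1 < p) (g : X → ℂ) (H : ℝ)
    (h : SamplingRecovery.lpNorm μ p g ≤ H) : ∫ x, ‖g x‖ ^ p ∂μ ≤ H ^ p := by
  have h0 : 0 ≤ ∫ x, ‖g x‖ ^ p ∂μ :=
    integral_nonneg fun _ => Real.rpow_nonneg (norm_nonneg _) _
  have := Real.rpow_le_rpow (aux_nonneg μ p g) h (by linarith : 0 ≤ p)
  rwa [SamplingRecovery.lpNorm, ← Real.rpow_mul h0, one_div_mul_cancel (by linarith),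
    Real.rpow_one] at this

lemma aux_le_int (hp : 1 < p) (g : X → ℂ) (H : ℝ) (hH : 0 ≤ H)
    (h : ∫ x, ‖g x‖ ^ p ∂μ ≤ H ^ p) : SamplingRecovery.lpNorm μ p g ≤ H := by
  have h0 : 0 ≤ ∫ x, ‖g x‖ ^ p ∂μ :=
    integral_nonneg fun _ => Real.rpow_nonneg (norm_nonneg _) _
  have := Real.rpow_le_rpow h0 h (by positivity : 0 ≤ 1 / p)
  rwa [← Real.rpow_mul hH, mul_one_div_cancel (by linarith), Real.rpow_one] at this

lemma aux_lim (hp : 1 < p) (g : ℕ → X → ℂ) (f : X → ℂ) (hg : ∀ n, Continuous (g n))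
    (hlim : ∀ x, Filter.Tendsto (fun n => g n x) Filter.atTop (nhds (f x))) (E : ℝ) (hE : 0 ≤ E)
    (h : ∀ᶠ n in Filter.atTop, SamplingRecovery.lpNorm μ p (g n) ≤ E) :
    SamplingRecovery.lpNorm μ p f ≤ E := by
  have hm : Measurable f := measurable_of_tendsto_metrizable (fun n => (hg n).measurable)
    (tendsto_pi_nhds.mpr hlim)
  have h1 : eLpNorm f (ENNReal.ofReal p) μ ≤ ENNReal.ofReal E := by
    refine (Lp.eLpNorm_lim_le_liminf_eLpNorm (fun n => (hg n).measurable.aestronglyMeasurable)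
      f (ae_of_all _ hlim)).trans ?_
    refine Filter.liminf_le_of_frequently_le' (Filter.Eventually.frequently ?_)
    filter_upwards [h] with n hn
    rw [aux_eLp μ p hp _ (aux_memLp μ p _ (hg n))]
    exact ENNReal.ofReal_le_ofReal hn
  have h2 : MemLp f (ENNReal.ofReal p) μ :=
    ⟨hm.aestronglyMeasurable, h1.trans_lt ENNReal.ofReal_lt_top⟩
  rw [aux_eLp μ p hp f h2] at h1
  exact (ENNReal.ofReal_le_ofReal_iff hE).mp h1
end norms

lemma aux_approx (p : ℝ) (hp : 1 < p) : ∃ K : ℝ, 0 < K ∧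
    ∀ (X : Type) [TopologicalSpace X] [CompactSpace X] [MeasurableSpace X]
    [BorelSpace X] (μ : Measure X) [IsProbabilityMeasure μ] (ι : Type) [DecidableEq ι]
    (s : Finset ι) (a : ι → ℂ) (ψ : ι → X → ℂ) (B : ℝ), (∀ k, Continuous (ψ k)) → 0 < B →
    (∀ k, SamplingRecovery.lpNorm μ p (ψ k) ≤ B) → ∀ n : ℕ, 0 < n →
    ∃ (F : Finset ι) (c : ι → ℂ), F ⊆ s ∧ F.card ≤ n ∧
      SamplingRecovery.lpNorm μ p (fun x => ∑ k ∈ s, a k * ψ k x - ∑ k ∈ F, c k * ψ k x) ≤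
        K * (∑ k ∈ s, ‖a k‖) * B * (n : ℝ) ^ (1 / min p 2 - 1) := by
  obtain ⟨K, hK1, hK⟩ := aux_maurey p hp
  have hq : 0 < min p 2 := lt_min (by linarith) (by norm_num)
  refine ⟨K ^ (1 / min p 2) * 2, by positivity, ?_⟩
  intro X _ _ _ _ μ _ ι _ s a ψ B hψ hB0 hB n hn
  set A := ∑ k ∈ s, ‖a k‖ with hA
  have hA0 : 0 ≤ A := Finset.sum_nonneg fun _ _ => norm_nonneg _
  rcases hA0.eq_or_lt with hA0 | hA0
  · refine ⟨∅, 0, by simp, by simp, ?_⟩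
    simp only [Finset.sum_empty, sub_zero]
    refine (aux_sum μ p hp s a ψ hψ B hB).trans ?_
    rw [← hA, ← hA0]; simp
  set P : X → ℂ := fun x => ∑ k ∈ s, a k * ψ k x with hP
  have hPc : Continuous P := by fun_prop
  set σ : ι → ℂ := fun k => (A : ℂ) * (a k / ‖a k‖) with hσ
  have hσn : ∀ k, ‖σ k‖ ≤ A := by
    intro k
    simp only [hσ, norm_mul, norm_div, Complex.norm_real, norm_norm, Real.norm_of_nonneg hA0.le]
    have : ‖a k‖ / ‖a k‖ ≤ 1 := div_self_le_one _
    nlinarith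
  have hσw : ∀ k, ((‖a k‖ / A : ℝ) : ℂ) * σ k = a k := by
    intro k
    simp only [hσ]
    by_cases h : a k = 0
    · simp [h]
    · have h1 : (A:ℂ) ≠ 0 := by exact_mod_cast hA0.ne'
      have h2 : (‖a k‖:ℂ) ≠ 0 := by exact_mod_cast (norm_pos_iff.mpr h).ne'
      push_cast
      field_simp
  set y : ι → X → ℂ := fun k x => σ k * ψ k x + (-1) * P x with hy
  have hyc : ∀ k, Continuous (y k) := by intro k; fun_prop
  have hw1 : ∑ k ∈ s, ‖a k‖ / A = 1 := by rw [← Finset.sum_div, ← hA, div_self hA0.ne']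
  obtain ⟨c, hcn, hc⟩ := hK X μ ι s (fun k => ‖a k‖ / A) y (2 * (A * B)) hyc
    (fun k _ => by positivity) hw1
    (by
      intro x
      simp only [hy, mul_add, Finset.sum_add_distrib, ← mul_assoc, hσw]
      simp only [← Finset.sum_mul]
      rw [← Complex.ofReal_sum, hw1]
      simp [hP])
    (by positivity)
    (by
      intro k _
      apply aux_int_le μ p hp
      refine (aux_add μ p hp _ _ (by fun_prop) (by fun_prop)).trans ?_
      rw [aux_smul μ p hp, aux_smul μ p hp, two_mul]
      apply add_le_add
      · exact mul_le_mul (hσn k) (hB k) (aux_nonneg _ _ _) hA0.le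
      · simpa using aux_sum μ p hp s a ψ hψ B hB) n
  have hn0 : (0:ℝ) < n := by exact_mod_cast hn
  have hnc : (n:ℂ) ≠ 0 := by exact_mod_cast hn.ne'
  have hc' := aux_le_int μ p hp _ _ (by positivity) hc
  refine ⟨s.filter fun k => c k ≠ 0, fun k => (c k : ℂ) * σ k / n, Finset.filter_subset _ _, ?_, ?_⟩
  · rw [← hcn, Finset.card_eq_sum_ones]
    calc ∑ k ∈ s with c k ≠ 0, 1 ≤ ∑ k ∈ s with c k ≠ 0, c k :=
          Finset.sum_le_sum fun k hk => Nat.one_le_iff_ne_zero.mpr (Finset.mem_filter.mp hk).2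
      _ ≤ ∑ k ∈ s, c k := Finset.sum_le_sum_of_subset (Finset.filter_subset _ _)
  · have heq : (fun x => P x - ∑ k ∈ s with c k ≠ 0, (c k : ℂ) * σ k / n * ψ k x) =
        fun x => (-(1 / (n:ℂ))) * ∑ k ∈ s, (c k : ℂ) * y k x := by
      funext x
      have e1 : ∑ k ∈ s with c k ≠ 0, (c k : ℂ) * σ k / n * ψ k x =
          ∑ k ∈ s, (c k : ℂ) * σ k / n * ψ k x := by
        rw [Finset.sum_filter]
        refine Finset.sum_congr rfl fun k _ => ?_
        by_cases h : c k = 0 <;> simp [h]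
      have e2 : ∑ k ∈ s, (c k : ℂ) * y k x = (∑ k ∈ s, (c k : ℂ) * σ k * ψ k x) - n * P x := by
        simp only [hy, mul_add, Finset.sum_add_distrib, ← mul_assoc, ← Finset.sum_mul]
        rw [← Nat.cast_sum, hcn]; ring
      rw [e1, e2]
      have e3 : ∑ k ∈ s, (c k : ℂ) * σ k / n * ψ k x =
          (1 / (n:ℂ)) * ∑ k ∈ s, (c k : ℂ) * σ k * ψ k x := by
        rw [Finset.mul_sum]
        refine Finset.sum_congr rfl fun k _ => ?_
        ring
      rw [e3]
      field_simp
      ring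
    rw [heq, aux_smul μ p hp]
    have : ‖-(1 / (n:ℂ))‖ = (n:ℝ)⁻¹ := by simp
    rw [this]
    calc (n:ℝ)⁻¹ * SamplingRecovery.lpNorm μ p (fun x => ∑ k ∈ s, (c k : ℂ) * y k x)
        ≤ (n:ℝ)⁻¹ * ((K * n) ^ (1 / min p 2) * (2 * (A * B))) := by gcongr
      _ = _ := by
        rw [Real.mul_rpow (by linarith) hn0.le, Real.rpow_sub_one hn0.ne']
        field_simp
lemma aux_mem_shell (d j : ℕ) (k : Fin d → ℤ) : k ∈ shell d j ↔
    (if j = 0 then (0 : ℝ) else (2 : ℝ) ^ (j - 1)) ≤ ‖k‖ ∧ ‖k‖ < (2 : ℝ) ^ j := by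
  unfold shell
  rw [Finset.mem_filter, and_iff_right_iff_imp, Finset.mem_Icc]
  rintro ⟨-, h⟩
  have hi : ∀ i, |k i| ≤ (2 ^ j : ℤ) := fun i => by
    have := (norm_le_pi_norm k i).trans h.le
    rw [Int.norm_eq_abs] at this
    exact_mod_cast this
  exact ⟨fun i => (abs_le.mp (hi i)).1, fun i => (abs_le.mp (hi i)).2⟩

lemma aux_mem_lball (d n : ℕ) (k : Fin d → ℤ) : k ∈ lball d n ↔ ‖k‖ < (n : ℝ) := by
  unfold lball
  rw [Finset.mem_filter, and_iff_right_iff_imp, Finset.mem_Icc]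
  intro h
  have hi : ∀ i, |k i| ≤ (n : ℤ) := fun i => by
    have := (norm_le_pi_norm k i).trans h.le
    rw [Int.norm_eq_abs] at this
    exact_mod_cast this
  exact ⟨fun i => (abs_le.mp (hi i)).1, fun i => (abs_le.mp (hi i)).2⟩

lemma aux_card_lball (d n : ℕ) : (lball d (2 ^ n)).card ≤ (2 ^ (n + 1)) ^ d := by
  have hsub : lball d (2 ^ n) ⊆ Fintype.piFinset fun _ => Finset.Ioo (-(2 ^ n : ℤ)) (2 ^ n) := by
    intro k hk
    rw [aux_mem_lball] at hk
    rw [Fintype.mem_piFinset]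
    intro i
    have := (norm_le_pi_norm k i).trans_lt hk
    rw [Int.norm_eq_abs] at this
    have h2 : |k i| < (2 ^ n : ℤ) := by exact_mod_cast this
    rw [Finset.mem_Ioo]
    exact abs_lt.mp h2
  refine (Finset.card_le_card hsub).trans ?_
  rw [Fintype.card_piFinset]
  simp only [Int.card_Ioo, Finset.prod_const, Finset.card_univ, Fintype.card_fin]
  gcongr
  rw [pow_succ]
  have : (0:ℤ) < 2 ^ n := by positivity
  zify
  omega

lemma aux_cover (d J N : ℕ) (k : Fin d → ℤ) (hN : k ∈ lball d (2 ^ N)) (hJ : k ∉ lball d (2 ^ J)) :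
    ∃ j ∈ Finset.Ioc J N, k ∈ shell d j := by
  rw [aux_mem_lball] at hN hJ
  push_cast at hN hJ
  have hex : ∃ j : ℕ, ‖k‖ < (2:ℝ) ^ j := ⟨N, hN⟩
  have h1 := Nat.find_spec hex
  have h2 : Nat.find hex ≤ N := Nat.find_min' hex hN
  have h3 : J < Nat.find hex := by
    by_contra h
    push Not at h hJ
    have : (2:ℝ) ^ (Nat.find hex) ≤ 2 ^ J := pow_le_pow_right₀ (by norm_num) h
    linarith
  refine ⟨Nat.find hex, Finset.mem_Ioc.mpr ⟨h3, h2⟩, ?_⟩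
  rw [aux_mem_shell, if_neg (by omega)]
  refine ⟨?_, h1⟩
  have := Nat.find_min hex (m := Nat.find hex - 1) (by omega)
  push Not at this
  exact this

lemma aux_geom (θ : ℝ) (hθ : 0 < θ) (n N : ℕ) :
    ∑ j ∈ Finset.Ioc n N, (2:ℝ) ^ (-(θ * ((j:ℝ) - n))) ≤ 1 / (2 ^ θ - 1) := by
  have h2 : (1:ℝ) < 2 ^ θ := Real.one_lt_rpow (by norm_num) hθ
  have h3 : (0:ℝ) < 2 ^ θ - 1 := by linarith
  rcases lt_or_ge N n with h | h
  · rw [Finset.Ioc_eq_empty (by omega)]; simp; linarith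
  suffices hs : ∑ j ∈ Finset.Ioc n N, (2:ℝ) ^ (-(θ * ((j:ℝ) - n))) ≤
      (1 - (2:ℝ) ^ (-(θ * ((N:ℝ) - n)))) / (2 ^ θ - 1) by
    refine hs.trans ?_
    gcongr
    have : (0:ℝ) < (2:ℝ) ^ (-(θ * ((N:ℝ) - n))) := by positivity
    linarith
  induction N, h using Nat.le_induction with
  | base => simp
  | succ N hN ih =>
    rw [← Finset.insert_Ioc_right_eq_Ioc_add_one (by omega), Finset.sum_insert (by simp)]
    have hx : (2:ℝ) ^ (-(θ * ((N:ℝ) - n))) = (2:ℝ) ^ (-(θ * (((N+1:ℕ):ℝ) - n))) * 2 ^ θ := by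
      rw [← Real.rpow_add (by norm_num)]; congr 1; push_cast; ring
    rw [hx] at ih
    refine (add_le_add_right ih _).trans (le_of_eq ?_)
    field_simp
    ring

lemma aux_thr_sum {ι : Type} (s : Finset ι) (a : ι → ℂ) (β Q m : ℝ) (hβ0 : 0 < β) (hβ1 : β ≤ 1)
    (hQ : 0 < Q) (hm : 0 < m) (h : ∑ k ∈ s, ‖a k‖ ^ β ≤ Q ^ β)
    (ht : ∀ k ∈ s, ‖a k‖ ≤ Q * m ^ (-(1 / β))) :
    ∑ k ∈ s, ‖a k‖ ≤ Q * m ^ (1 - 1 / β) := by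
  have h1 : ∀ k ∈ s, ‖a k‖ ≤ (Q * m ^ (-(1 / β))) ^ (1 - β) * ‖a k‖ ^ β := by
    intro k hk
    rcases (norm_nonneg (a k)).eq_or_lt with h0 | h0
    · rw [← h0]; positivity
    · calc ‖a k‖ = ‖a k‖ ^ (1 - β) * ‖a k‖ ^ β := by
            rw [← Real.rpow_add h0]; simp
        _ ≤ _ := by
            gcongr
            exact ht k hk
  calc ∑ k ∈ s, ‖a k‖ ≤ ∑ k ∈ s, (Q * m ^ (-(1 / β))) ^ (1 - β) * ‖a k‖ ^ β := Finset.sum_le_sum h1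
    _ = (Q * m ^ (-(1 / β))) ^ (1 - β) * ∑ k ∈ s, ‖a k‖ ^ β := by rw [Finset.mul_sum]
    _ ≤ (Q * m ^ (-(1 / β))) ^ (1 - β) * Q ^ β := by gcongr
    _ = Q * m ^ (1 - 1 / β) := by
      rw [Real.mul_rpow hQ.le (by positivity), ← Real.rpow_mul hm.le, mul_right_comm,
        ← Real.rpow_add hQ]
      have e1 : 1 - β + β = 1 := by ring
      have e2 : -(1 / β) * (1 - β) = 1 - 1 / β := by field_simp; ring
      rw [e1, e2, Real.rpow_one]

lemma aux_thr_card {ι : Type} (s : Finset ι) (a : ι → ℂ) (β Q m : ℝ) (hβ0 : 0 < β)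
    (hQ : 0 < Q) (hm : 0 < m) (h : ∑ k ∈ s, ‖a k‖ ^ β ≤ Q ^ β) :
    ((s.filter fun k => Q * m ^ (-(1 / β)) ≤ ‖a k‖).card : ℝ) ≤ m := by
  set t := Q * m ^ (-(1 / β)) with ht
  have ht0 : 0 < t := by positivity
  have htb : t ^ β = Q ^ β * m⁻¹ := by
    rw [ht, Real.mul_rpow hQ.le (by positivity), ← Real.rpow_mul hm.le]
    have : -(1 / β) * β = -1 := by field_simp
    rw [this, Real.rpow_neg_one]
  have h1 : ((s.filter fun k => t ≤ ‖a k‖).card : ℝ) * t ^ β ≤ Q ^ β := by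
    calc ((s.filter fun k => t ≤ ‖a k‖).card : ℝ) * t ^ β = ∑ k ∈ s with t ≤ ‖a k‖, t ^ β := by
          rw [Finset.sum_const, nsmul_eq_mul]
      _ ≤ ∑ k ∈ s with t ≤ ‖a k‖, ‖a k‖ ^ β := by
          refine Finset.sum_le_sum fun k hk => ?_
          have := (Finset.mem_filter.mp hk).2
          gcongr
      _ ≤ ∑ k ∈ s, ‖a k‖ ^ β :=
          Finset.sum_le_sum_of_subset_of_nonneg (Finset.filter_subset _ _)
            fun _ _ _ => by positivity
      _ ≤ _ := h
  have hQb : 0 < Q ^ β := by positivity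
  rw [htb] at h1
  have : ((s.filter fun k => t ≤ ‖a k‖).card : ℝ) * m⁻¹ ≤ 1 := by
    by_contra hcon
    push Not at hcon
    nlinarith
  rwa [← div_eq_mul_inv, div_le_one hm] at this

lemma aux_sum_biUnion {ι κ : Type} [DecidableEq ι] [DecidableEq κ] (s : Finset ι) (t : Finset κ)
    (g : κ → Finset ι) (a : ι → ℂ) (h : ∀ k ∈ s, ∃ j ∈ t, k ∈ g j) :
    ∑ k ∈ s, ‖a k‖ ≤ ∑ j ∈ t, ∑ k ∈ g j, ‖a k‖ := by
  calc ∑ k ∈ s, ‖a k‖ ≤ ∑ k ∈ s, ∑ j ∈ t, if k ∈ g j then ‖a k‖ else 0 := by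
        refine Finset.sum_le_sum fun k hk => ?_
        obtain ⟨j, hj, hkj⟩ := h k hk
        have := Finset.single_le_sum (f := fun j => if k ∈ g j then ‖a k‖ else 0)
          (fun i _ => by positivity) hj
        simpa [hkj] using this
    _ = ∑ j ∈ t, ∑ k ∈ s, if k ∈ g j then ‖a k‖ else 0 := Finset.sum_comm
    _ ≤ ∑ j ∈ t, ∑ k ∈ g j, ‖a k‖ := by
        refine Finset.sum_le_sum fun j _ => ?_
        rw [← Finset.sum_filter]
        exact Finset.sum_le_sum_of_subset_of_nonneg
          (fun k hk => (Finset.mem_filter.mp hk).2) fun _ _ _ => norm_nonneg _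

section cls
variable {d : ℕ} (a : (Fin d → ℤ) → ℂ) (β r : ℝ) (hβ0 : 0 < β) (hβ1 : β ≤ 1) (hr : 0 < r)
  (ha : ∀ j : ℕ, (∑ k ∈ shell d j, ‖a k‖ ^ β) ^ (1 / β) ≤ (2 : ℝ) ^ (-(r * j)))

lemma aux_cls (j : ℕ) (hβ0 : 0 < β)
  (ha : ∀ j : ℕ, (∑ k ∈ shell d j, ‖a k‖ ^ β) ^ (1 / β) ≤ (2 : ℝ) ^ (-(r * j))) :
    ∑ k ∈ shell d j, ‖a k‖ ^ β ≤ ((2 : ℝ) ^ (-(r * j))) ^ β := by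
  have h0 : 0 ≤ ∑ k ∈ shell d j, ‖a k‖ ^ β := Finset.sum_nonneg fun _ _ => by positivity
  have := Real.rpow_le_rpow (by positivity) (ha j) hβ0.le
  rwa [← Real.rpow_mul h0, one_div_mul_cancel hβ0.ne', Real.rpow_one] at this

lemma aux_cls_l1 (j : ℕ) (hβ0 : 0 < β) (hβ1 : β ≤ 1)
  (ha : ∀ j : ℕ, (∑ k ∈ shell d j, ‖a k‖ ^ β) ^ (1 / β) ≤ (2 : ℝ) ^ (-(r * j))) :
    ∑ k ∈ shell d j, ‖a k‖ ≤ (2 : ℝ) ^ (-(r * j)) := by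
  have h := aux_cls a β r j hβ0 ha
  have := aux_thr_sum (shell d j) a β ((2 : ℝ) ^ (-(r * j))) 1 hβ0 hβ1 (by positivity) one_pos h
    (by
      intro k hk
      have h1 : ‖a k‖ ^ β ≤ ((2 : ℝ) ^ (-(r * j))) ^ β :=
        (Finset.single_le_sum (f := fun k => ‖a k‖ ^ β) (fun _ _ => by positivity) hk).trans h
      rw [Real.one_rpow, mul_one]
      exact (Real.rpow_le_rpow_iff (norm_nonneg _) (by positivity) hβ0).mp h1)
  simpa using this

lemma aux_tail (J N : ℕ) (hβ0 : 0 < β) (hβ1 : β ≤ 1) (hr : 0 < r)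
  (ha : ∀ j : ℕ, (∑ k ∈ shell d j, ‖a k‖ ^ β) ^ (1 / β) ≤ (2 : ℝ) ^ (-(r * j))) :
    ∑ k ∈ lball d (2 ^ N) \ lball d (2 ^ J), ‖a k‖ ≤ (2:ℝ) ^ (-(r * J)) * (1 / (2 ^ r - 1)) := by
  refine (aux_sum_biUnion _ (Finset.Ioc J N) (shell d) a fun k hk => ?_).trans ?_
  · rw [Finset.mem_sdiff] at hk
    exact aux_cover d J N k hk.1 hk.2
  · refine (Finset.sum_le_sum fun j _ => aux_cls_l1 a β r j hβ0 hβ1 ha).trans ?_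
    have : ∀ j : ℕ, (2:ℝ) ^ (-(r * j)) = (2:ℝ) ^ (-(r * J)) * (2:ℝ) ^ (-(r * ((j:ℝ) - J))) := by
      intro j
      rw [← Real.rpow_add (by norm_num)]; congr 1; ring
    rw [Finset.sum_congr rfl fun j _ => this j, ← Finset.mul_sum]
    gcongr
    exact aux_geom r hr J N

lemma aux_zero (hβ0 : 0 < β) (hβ1 : β ≤ 1)
  (ha : ∀ j : ℕ, (∑ k ∈ shell d j, ‖a k‖ ^ β) ^ (1 / β) ≤ (2 : ℝ) ^ (-(r * j))) :
    ∑ k ∈ lball d (2 ^ 0), ‖a k‖ ≤ 1 := by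
  have h := aux_cls_l1 a β r 0 hβ0 hβ1 ha
  simp only [Nat.cast_zero, mul_zero, neg_zero, Real.rpow_zero] at h
  refine (Finset.sum_le_sum_of_subset_of_nonneg (fun k hk => ?_) fun _ _ _ => norm_nonneg _).trans h
  rw [aux_mem_lball] at hk
  rw [aux_mem_shell]
  simpa using hk

lemma aux_split (n J : ℕ) (M κ : ℝ) (hM : 0 < M) (hβ0 : 0 < β) (hβ1 : β ≤ 1)
  (ha : ∀ j : ℕ, (∑ k ∈ shell d j, ‖a k‖ ^ β) ^ (1 / β) ≤ (2 : ℝ) ^ (-(r * j))) :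
    ∃ T : Finset (Fin d → ℤ),
      (T.card : ℝ) ≤ (2 ^ (n + 1)) ^ d +
        ∑ j ∈ Finset.Ioc n J, M * (2:ℝ) ^ (-(κ * ((j:ℝ) - n))) ∧
      ∑ k ∈ lball d (2 ^ J) \ T, ‖a k‖ ≤ ∑ j ∈ Finset.Ioc n J,
        (2:ℝ) ^ (-(r * j)) * (M * (2:ℝ) ^ (-(κ * ((j:ℝ) - n)))) ^ (1 - 1 / β) := by
  set m : ℕ → ℝ := fun j => M * (2:ℝ) ^ (-(κ * ((j:ℝ) - n))) with hm
  have hm0 : ∀ j, 0 < m j := fun j => by positivity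
  set t : ℕ → ℝ := fun j => (2:ℝ) ^ (-(r * j)) * m j ^ (-(1 / β)) with ht
  refine ⟨lball d (2 ^ n) ∪ (Finset.Ioc n J).biUnion
    fun j => (shell d j).filter fun k => t j ≤ ‖a k‖, ?_, ?_⟩
  · have h1 := Finset.card_union_le (lball d (2 ^ n)) ((Finset.Ioc n J).biUnion
      fun j => (shell d j).filter fun k => t j ≤ ‖a k‖)
    have h2 := Finset.card_biUnion_le (s := Finset.Ioc n J)
      (t := fun j => (shell d j).filter fun k => t j ≤ ‖a k‖)
    have h3 := aux_card_lball d n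
    have h4 := h1.trans (add_le_add h3 h2)
    have h5 : ((lball d (2 ^ n) ∪ (Finset.Ioc n J).biUnion
      fun j => (shell d j).filter fun k => t j ≤ ‖a k‖).card : ℝ) ≤ (2 ^ (n + 1)) ^ d +
        ∑ j ∈ Finset.Ioc n J, (((shell d j).filter fun k => t j ≤ ‖a k‖).card : ℝ) := by
      exact_mod_cast h4
    refine h5.trans ?_
    gcongr with j hj
    exact aux_thr_card (shell d j) a β _ (m j) hβ0 (by positivity) (hm0 j)
      (aux_cls a β r j hβ0 ha)
  · refine (aux_sum_biUnion _ (Finset.Ioc n J)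
      (fun j => (shell d j).filter fun k => ‖a k‖ ≤ t j) a fun k hk => ?_).trans ?_
    · rw [Finset.mem_sdiff, Finset.mem_union, Finset.mem_biUnion] at hk
      obtain ⟨hk1, hk2⟩ := hk
      push Not at hk2
      obtain ⟨j, hj, hkj⟩ := aux_cover d n J k hk1 hk2.1
      refine ⟨j, hj, Finset.mem_filter.mpr ⟨hkj, ?_⟩⟩
      by_contra hcon
      push Not at hcon
      exact hk2.2 j hj (Finset.mem_filter.mpr ⟨hkj, hcon.le⟩)
    · refine Finset.sum_le_sum fun j hj => ?_
      refine aux_thr_sum _ a β _ (m j) hβ0 hβ1 (by positivity) (hm0 j) ?_ ?_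
      · exact (Finset.sum_le_sum_of_subset_of_nonneg (Finset.filter_subset _ _)
            fun _ _ _ => by positivity).trans (aux_cls a β r j hβ0 ha)
      · intro k hk
        exact (Finset.mem_filter.mp hk).2
end cls

lemma aux_core {d : ℕ} {X : Type} [TopologicalSpace X] [CompactSpace X] [MeasurableSpace X]
    [BorelSpace X] (μ : Measure X) [IsProbabilityMeasure μ] (p : ℝ) (hp : 1 < p)
    (ψ : (Fin d → ℤ) → X → ℂ) (hψ : ∀ k, Continuous (ψ k)) (B : ℝ) (hB0 : 0 < B)
    (hB : ∀ k, SamplingRecovery.lpNorm μ p (ψ k) ≤ B) (β r : ℝ) (hβ0 : 0 < β) (hβ1 : β ≤ 1)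
    (hr : 0 < r) (a : (Fin d → ℤ) → ℂ) (f : X → ℂ)
    (hf : ∀ x, HasSum (fun k => a k * ψ k x) (f x))
    (ha : ∀ j : ℕ, (∑ k ∈ shell d j, ‖a k‖ ^ β) ^ (1 / β) ≤ (2 : ℝ) ^ (-(r * j)))
    (J v : ℕ) (F : Finset (Fin d → ℤ)) (c : (Fin d → ℤ) → ℂ) (hF : F ⊆ lball d (2 ^ J))
    (hFv : F.card ≤ v) (E : ℝ)
    (hE : SamplingRecovery.lpNorm μ p
      (fun x => ∑ k ∈ lball d (2 ^ J), a k * ψ k x - ∑ k ∈ F, c k * ψ k x) ≤ E) :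
    sigmaErrOn (SamplingRecovery.lpNorm μ p) ψ (lball d (2 ^ J)) v f ≤
      E + (2:ℝ) ^ (-(r * J)) * (1 / (2 ^ r - 1)) * B := by
  have h2 : (1:ℝ) < 2 ^ r := Real.one_lt_rpow (by norm_num) hr
  have h3 : (0:ℝ) < 1 / (2 ^ r - 1) := by
    have : (0:ℝ) < 2 ^ r - 1 := by linarith
    positivity
  have hE0 : 0 ≤ E := (aux_nonneg _ _ _).trans hE
  have hle : sigmaErrOn (SamplingRecovery.lpNorm μ p) ψ (lball d (2 ^ J)) v f ≤
      SamplingRecovery.lpNorm μ p (f - fun x => ∑ k ∈ F, c k * ψ k x) := by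
    apply csInf_le
    · refine ⟨0, ?_⟩
      rintro _ ⟨h, -, rfl⟩
      exact aux_nonneg _ _ _
    · exact ⟨_, ⟨F, c, hF, hFv, rfl⟩, rfl⟩
  refine hle.trans ?_
  apply aux_lim μ p hp
    (fun N x => ∑ k ∈ lball d (2 ^ N), a k * ψ k x - ∑ k ∈ F, c k * ψ k x)
  · intro N; fun_prop
  · intro x
    have htop : Filter.Tendsto (fun N => lball d (2 ^ N)) Filter.atTop Filter.atTop := by
      apply Filter.tendsto_atTop_finset_of_monotone
      · intro N N' hN k hk
        rw [aux_mem_lball] at hk ⊢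
        refine hk.trans_le ?_
        exact_mod_cast Nat.pow_le_pow_right (by norm_num) hN
      · intro k
        obtain ⟨N, hN⟩ := pow_unbounded_of_one_lt ‖k‖ (by norm_num : (1:ℝ) < 2)
        refine ⟨N, ?_⟩
        rw [aux_mem_lball]; exact_mod_cast hN
    have := (hf x).comp htop
    exact this.sub_const _
  · positivity
  · filter_upwards [Filter.eventually_ge_atTop J] with N hN
    have hsub : lball d (2 ^ J) ⊆ lball d (2 ^ N) := by
      intro k hk
      rw [aux_mem_lball] at hk ⊢
      refine hk.trans_le ?_
      exact_mod_cast Nat.pow_le_pow_right (by norm_num) hN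
    have heq : (fun x => ∑ k ∈ lball d (2 ^ N), a k * ψ k x - ∑ k ∈ F, c k * ψ k x) =
      fun x => (∑ k ∈ lball d (2 ^ J), a k * ψ k x - ∑ k ∈ F, c k * ψ k x) +
        ∑ k ∈ lball d (2 ^ N) \ lball d (2 ^ J), a k * ψ k x := by
      funext x
      rw [← Finset.sum_sdiff hsub]; ring
    rw [heq]
    refine (aux_add μ p hp _ _ (by fun_prop) (by fun_prop)).trans ?_
    refine add_le_add hE ((aux_sum μ p hp _ a ψ hψ B hB).trans ?_)
    gcongr
    exact aux_tail a β r J N hβ0 hβ1 hr ha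

set_option maxHeartbeats 1000000 in
lemma aux_large (r β p : ℝ) (d : ℕ)
    (hr : 0 < r) (hβ0 : 0 < β) (hβ1 : β ≤ 1) (hp : 1 < p) (hd : 0 < d) :
    ∃ C : ℝ, 0 < C ∧ ∀ (X : Type) [TopologicalSpace X] [CompactSpace X] [MeasurableSpace X]
    [BorelSpace X] (μ : Measure X) [IsProbabilityMeasure μ]
    (ψ : (Fin d → ℤ) → X → ℂ) (_ : ∀ k, Continuous (ψ k)) (B : ℝ) (_ : 0 < B)
    (_ : ∀ k, SamplingRecovery.lpNorm μ p (ψ k) ≤ B) (a : (Fin d → ℤ) → ℂ)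
    (_ : ∀ j : ℕ, (∑ k ∈ shell d j, ‖a k‖ ^ β) ^ (1 / β) ≤ (2 : ℝ) ^ (-(r * j)))
    (J v : ℕ) (_ : 3 * 2 ^ d ≤ v),
    ∃ (F : Finset (Fin d → ℤ)) (c : (Fin d → ℤ) → ℂ), F ⊆ lball d (2 ^ J) ∧ F.card ≤ v ∧
      SamplingRecovery.lpNorm μ p
        (fun x => ∑ k ∈ lball d (2 ^ J), a k * ψ k x - ∑ k ∈ F, c k * ψ k x) ≤
      C * B * (v : ℝ) ^ (1 / min p 2 - 1 / β - r / d) := by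
  obtain ⟨K, hK0, hK⟩ := aux_approx p hp
  set q := min p 2 with hq
  have hq1 : 1 < q := lt_min hp (by norm_num)
  have hq1' : 1 / q - 1 ≤ 0 := by
    have : 1 / q ≤ 1 := by rw [div_le_one (by linarith)]; exact hq1.le
    linarith
  set κ := r * β / 2 with hκ
  have hκ0 : 0 < κ := by positivity
  set θ := r + κ * (1 - 1 / β) with hθ
  have hθ0 : 0 < θ := by
    have : θ = r * (1 + β) / 2 := by rw [hθ, hκ]; field_simp; ring
    rw [this]; positivity
  have h2κ : (0:ℝ) < 2 ^ κ - 1 := by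
    have : (1:ℝ) < 2 ^ κ := Real.one_lt_rpow (by norm_num) hκ0
    linarith
  have h2θ : (0:ℝ) < 2 ^ θ - 1 := by
    have : (1:ℝ) < 2 ^ θ := Real.one_lt_rpow (by norm_num) hθ0
    linarith
  set δ : ℝ := ((2:ℝ) ^ κ - 1) / 3 with hδ
  have hδ0 : 0 < δ := by positivity
  have hd0 : (0:ℝ) < d := by exact_mod_cast hd
  refine ⟨K * (δ ^ (1 - 1 / β) * (3 * 4 ^ d : ℝ)⁻¹ ^ (-(r / d)) * (1 / (2 ^ θ - 1))) *
    (6:ℝ)⁻¹ ^ (1 / q - 1), by positivity, ?_⟩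
  intro X _ _ _ _ μ _ ψ hψ B hB0 hB a ha J v hv
  have hvR : (3 * 2 ^ d : ℝ) ≤ v := by exact_mod_cast hv
  have h2d1 : (1:ℝ) ≤ 2 ^ d := one_le_pow₀ (by norm_num)
  have hv0 : (0:ℝ) < v := by linarith
  obtain ⟨n, hn1, hn2⟩ := exists_nat_pow_near (x := (v:ℝ) / (3 * 2 ^ d)) (y := (2:ℝ) ^ d)
    (by rw [le_div_iff₀ (by positivity)]; linarith) (one_lt_pow₀ (by norm_num) hd.ne')
  rw [le_div_iff₀ (by positivity)] at hn1
  rw [div_lt_iff₀ (by positivity)] at hn2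
  obtain ⟨T, hT1, hT2⟩ := aux_split a β r n J (δ * v) κ (by positivity) hβ0 hβ1 ha
  have hTcard : (T.card : ℝ) ≤ v / 3 + v / 3 := by
    refine hT1.trans (add_le_add ?_ ?_)
    · have : ((2:ℝ) ^ (n + 1)) ^ d = ((2:ℝ) ^ d) ^ n * 2 ^ d := by
        rw [← pow_mul, ← pow_mul, ← pow_add]; congr 1; ring
      rw [this]; linarith
    · rw [← Finset.mul_sum]
      calc δ * v * ∑ j ∈ Finset.Ioc n J, (2:ℝ) ^ (-(κ * ((j:ℝ) - n)))
          ≤ δ * v * (1 / (2 ^ κ - 1)) := by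
            gcongr
            exact aux_geom κ hκ0 n J
        _ = v / 3 := by rw [hδ]; field_simp
  set R := lball d (2 ^ J) \ T with hR
  have hAle : ∑ k ∈ R, ‖a k‖ ≤ δ ^ (1 - 1 / β) * (3 * 4 ^ d : ℝ)⁻¹ ^ (-(r / d)) *
      (1 / (2 ^ θ - 1)) * ((v:ℝ) ^ (1 - 1 / β) * (v:ℝ) ^ (-(r / d))) := by
    refine hT2.trans ?_
    have e1 : ∀ j : ℕ, (2:ℝ) ^ (-(r * j)) *
        (δ * v * (2:ℝ) ^ (-(κ * ((j:ℝ) - n)))) ^ (1 - 1 / β) =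
        (δ ^ (1 - 1 / β) * (v:ℝ) ^ (1 - 1 / β) * (2:ℝ) ^ (-(r * n))) *
          (2:ℝ) ^ (-(θ * ((j:ℝ) - n))) := by
      intro j
      rw [Real.mul_rpow (by positivity) (by positivity), Real.mul_rpow hδ0.le hv0.le,
        ← Real.rpow_mul (by norm_num : (0:ℝ) ≤ 2)]
      have : (2:ℝ) ^ (-(r * j)) * (2:ℝ) ^ (-(κ * ((j:ℝ) - n)) * (1 - 1 / β)) =
          (2:ℝ) ^ (-(r * n)) * (2:ℝ) ^ (-(θ * ((j:ℝ) - n))) := by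
        rw [← Real.rpow_add (by norm_num), ← Real.rpow_add (by norm_num)]
        congr 1
        rw [hθ]; ring
      linear_combination (δ ^ (1 - 1 / β) * (v:ℝ) ^ (1 - 1 / β)) * this
    rw [Finset.sum_congr rfl fun j _ => e1 j, ← Finset.mul_sum]
    have e2 : (2:ℝ) ^ (-(r * n)) ≤ (3 * 4 ^ d : ℝ)⁻¹ ^ (-(r / d)) * (v:ℝ) ^ (-(r / d)) := by
      rw [← Real.mul_rpow (by positivity) hv0.le]
      have : (2:ℝ) ^ (-(r * n)) = (((2:ℝ) ^ d) ^ n) ^ (-(r / d)) := by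
        rw [← pow_mul, ← Real.rpow_natCast, ← Real.rpow_mul (by norm_num)]
        congr 1; push_cast; field_simp
      rw [this]
      apply Real.rpow_le_rpow_of_nonpos (by positivity)
      · rw [inv_mul_le_iff₀ (by positivity)]
        have h4 : (4:ℝ) ^ d = 2 ^ d * 2 ^ d := by rw [← mul_pow]; norm_num
        rw [h4]
        refine hn2.le.trans (le_of_eq ?_)
        ring
      · have : 0 < r / d := by positivity
        linarith
    calc δ ^ (1 - 1 / β) * (v:ℝ) ^ (1 - 1 / β) * (2:ℝ) ^ (-(r * n)) *
          ∑ j ∈ Finset.Ioc n J, (2:ℝ) ^ (-(θ * ((j:ℝ) - n)))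
        ≤ δ ^ (1 - 1 / β) * (v:ℝ) ^ (1 - 1 / β) *
          ((3 * 4 ^ d : ℝ)⁻¹ ^ (-(r / d)) * (v:ℝ) ^ (-(r / d))) * (1 / (2 ^ θ - 1)) := by
          gcongr
          exact aux_geom θ hθ0 n J
      _ = _ := by ring
  have hv3 : 3 ≤ v := by
    have : 1 ≤ 2 ^ d := Nat.one_le_two_pow
    omega
  obtain ⟨F, c, hFR, hFc, hFe⟩ := hK X μ (Fin d → ℤ) R a ψ B hψ hB0 hB (v / 3) (by omega)
  set S := lball d (2 ^ J) ∩ T with hS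
  have hdisj : Disjoint S R := by
    rw [hS, hR, Finset.disjoint_left]
    intro k hk hk'
    exact (Finset.mem_sdiff.mp hk').2 (Finset.mem_inter.mp hk).2
  have hdisj' : Disjoint S F := hdisj.mono_right hFR
  refine ⟨S ∪ F, fun k => if k ∈ S then a k else c k, ?_, ?_, ?_⟩
  · exact Finset.union_subset Finset.inter_subset_left (hFR.trans Finset.sdiff_subset)
  · have h1 : S.card ≤ T.card := Finset.card_le_card Finset.inter_subset_right
    have h2 : 3 * T.card ≤ 2 * v := by
      have : (3:ℝ) * T.card ≤ 2 * v := by linarith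
      exact_mod_cast this
    have h3 := Finset.card_union_le S F
    omega
  · have heq : (fun x => ∑ k ∈ lball d (2 ^ J), a k * ψ k x -
        ∑ k ∈ S ∪ F, (if k ∈ S then a k else c k) * ψ k x) =
        fun x => ∑ k ∈ R, a k * ψ k x - ∑ k ∈ F, c k * ψ k x := by
      funext x
      have e1 : ∑ k ∈ lball d (2 ^ J), a k * ψ k x =
          ∑ k ∈ S, a k * ψ k x + ∑ k ∈ R, a k * ψ k x := by
        rw [← Finset.sum_union hdisj, hS, hR, Finset.union_comm, Finset.sdiff_union_inter]
      have e2 : ∑ k ∈ S, (if k ∈ S then a k else c k) * ψ k x = ∑ k ∈ S, a k * ψ k x :=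
        Finset.sum_congr rfl fun k hk => by rw [if_pos hk]
      have e3 : ∑ k ∈ F, (if k ∈ S then a k else c k) * ψ k x = ∑ k ∈ F, c k * ψ k x :=
        Finset.sum_congr rfl fun k hk => by
          rw [if_neg (Finset.disjoint_right.mp hdisj' hk)]
      rw [e1, Finset.sum_union hdisj', e2, e3]; ring
    rw [heq]
    refine hFe.trans ?_
    have hm : ((v / 3 : ℕ) : ℝ) ^ (1 / q - 1) ≤ (6:ℝ)⁻¹ ^ (1 / q - 1) * (v:ℝ) ^ (1 / q - 1) := by
      rw [← Real.mul_rpow (by norm_num) hv0.le]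
      apply Real.rpow_le_rpow_of_nonpos (by positivity) _ hq1'
      have h6 : v ≤ 6 * (v / 3) := by omega
      have : (v:ℝ) ≤ 6 * ((v / 3 : ℕ) : ℝ) := by exact_mod_cast h6
      linarith
    have hexp : (v:ℝ) ^ (1 / q - 1 / β - r / d) =
        (v:ℝ) ^ (1 - 1 / β) * (v:ℝ) ^ (-(r / d)) * (v:ℝ) ^ (1 / q - 1) := by
      rw [← Real.rpow_add hv0, ← Real.rpow_add hv0]; congr 1; ring
    rw [hexp]
    calc K * (∑ k ∈ R, ‖a k‖) * B * ((v / 3 : ℕ) : ℝ) ^ (1 / q - 1)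
        ≤ K * (δ ^ (1 - 1 / β) * (3 * 4 ^ d : ℝ)⁻¹ ^ (-(r / d)) *
      (1 / (2 ^ θ - 1)) * ((v:ℝ) ^ (1 - 1 / β) * (v:ℝ) ^ (-(r / d)))) * B *
          ((6:ℝ)⁻¹ ^ (1 / q - 1) * (v:ℝ) ^ (1 / q - 1)) := by gcongr
      _ = _ := by ring

/-- Theorem 4.1: best `v`-term approximation of the class `A^r_β(Ψ)` from
the block `Ψ_J = {ψ_k : ‖k‖_∞ < 2^J}`.  If `‖ψ_k‖_{L_p(Ω,μ)} ≤ B`, then there are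
constants `c, C` depending only on `r, β, p, d` such that for any `v` there is `J` with
`2^J ≤ v^c` (chosen independently of `μ`) and
`σ_v(f, Ψ_J)_{L_p(Ω,μ)} ≤ C B v^{1/p* − 1/β − r/d}` for every `f ∈ A^r_β(Ψ)`,
where `p* = min(p,2)`. -/
theorem sparse_approximation_ArClass (r β p : ℝ) (d : ℕ)
    (hr : 0 < r) (hβ0 : 0 < β) (hβ1 : β ≤ 1) (hp : 1 < p) (hd : 0 < d) :
    ∃ c C : ℝ, 0 < c ∧ 0 < C ∧
    ∀ (Ω : Set (Fin d → ℝ)), IsCompact Ω →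
    ∀ (ψ : (Fin d → ℤ) → Ω → ℂ), (∀ k, Continuous (ψ k)) →
    ∀ B : ℝ, 0 ≤ B →
    ∀ v : ℕ, 0 < v →
    ∃ J : ℕ, (2 : ℝ) ^ J ≤ (v : ℝ) ^ c ∧
      ∀ μ : Measure Ω, IsProbabilityMeasure μ →
        (∀ k, lpNorm μ p (ψ k) ≤ B) →
        ∀ f ∈ ArClass ψ β r,
          sigmaErrOn (lpNorm μ p) ψ (lball d (2 ^ J)) v f ≤
            C * B * (v : ℝ) ^ (1 / min p 2 - 1 / β - r / d) := by
  obtain ⟨C₁, hC₁, hlarge⟩ := aux_large r β p d hr hβ0 hβ1 hp hd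
  have hd0 : (0:ℝ) < d := by exact_mod_cast hd
  have hq1 : 1 < min p 2 := lt_min hp (by norm_num)
  have h2r : (0:ℝ) < 2 ^ r - 1 := by
    have : (1:ℝ) < 2 ^ r := Real.one_lt_rpow (by norm_num) hr
    linarith
  set g := 1 / ((2:ℝ) ^ r - 1) with hg
  have hg0 : 0 < g := by positivity
  set c := (1 / β + r / d) / r with hc
  have hc0 : 0 < c := by positivity
  set e := 1 / min p 2 - 1 / β - r / d with he
  have he0 : e ≤ 0 := by
    have h1 : 1 / min p 2 ≤ 1 := by rw [div_le_one (by linarith)]; exact hq1.le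
    have h2 : 1 ≤ 1 / β := by rw [le_div_iff₀ hβ0]; linarith
    have h3 : 0 < r / d := by positivity
    rw [he]; linarith
  have hV0 : (0:ℝ) < (3 * 2 ^ d) ^ (-e) := by positivity
  refine ⟨c, C₁ + 2 ^ r * g + (1 + g) * (3 * 2 ^ d) ^ (-e), hc0, by positivity, ?_⟩
  set C := C₁ + 2 ^ r * g + (1 + g) * (3 * 2 ^ d) ^ (-e) with hC
  intro Ω hΩ ψ hψ B hB0 v hv
  haveI : CompactSpace Ω := isCompact_iff_compactSpace.mp hΩ
  have hv1 : (1:ℝ) ≤ v := by exact_mod_cast hv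
  have hvpos : (0:ℝ) < v := by linarith
  have hve : 0 < (v:ℝ) ^ e := by positivity
  -- it suffices to treat positive constants
  suffices hs : ∃ J : ℕ, (2 : ℝ) ^ J ≤ (v : ℝ) ^ c ∧
      ∀ B' : ℝ, 0 < B' → ∀ μ : Measure Ω, IsProbabilityMeasure μ →
        (∀ k, SamplingRecovery.lpNorm μ p (ψ k) ≤ B') →
        ∀ f ∈ ArClass ψ β r,
          sigmaErrOn (SamplingRecovery.lpNorm μ p) ψ (lball d (2 ^ J)) v f ≤
            C * B' * (v : ℝ) ^ e by
    obtain ⟨J, hJ, h⟩ := hs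
    refine ⟨J, hJ, fun μ hμ hB f hf => ?_⟩
    apply le_of_forall_pos_le_add
    intro ε hε
    have hCp : 0 < C * (v:ℝ) ^ e := by positivity
    have := h (B + ε / (C * (v:ℝ) ^ e)) (by positivity) μ hμ
      (fun k => (hB k).trans (by
        have : 0 < ε / (C * (v:ℝ) ^ e) := by positivity
        linarith)) f hf
    refine this.trans (le_of_eq ?_)
    rw [show C * (B + ε / (C * (v:ℝ) ^ e)) * (v:ℝ) ^ e = C * B * (v:ℝ) ^ e +
      ε / (C * (v:ℝ) ^ e) * (C * (v:ℝ) ^ e) by ring, div_mul_cancel₀ _ hCp.ne']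
  rcases lt_or_ge v (3 * 2 ^ d) with hsmall | hbig
  · refine ⟨0, by simpa using Real.one_le_rpow hv1 hc0.le, ?_⟩
    intro B hB0 μ hμ hB f hf
    obtain ⟨a, -, hfs, ha⟩ := hf
    have h0 := aux_core μ p hp ψ hψ B hB0 hB β r hβ0 hβ1 hr a f hfs ha 0 v ∅ 0 (by simp)
      (by simp) (1 * B) (by
        simp only [Finset.sum_empty, sub_zero]
        refine (aux_sum μ p hp _ a ψ hψ B hB).trans ?_
        gcongr
        exact aux_zero a β r hβ0 hβ1 ha)
    refine h0.trans ?_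
    simp only [Nat.cast_zero, mul_zero, neg_zero, Real.rpow_zero, one_mul]
    rw [← hg]
    have hvs : (v:ℝ) ≤ 3 * 2 ^ d := by exact_mod_cast hsmall.le
    have h1 : 1 ≤ (3 * 2 ^ d : ℝ) ^ (-e) * (v:ℝ) ^ e := by
      calc (1:ℝ) = (3 * 2 ^ d : ℝ) ^ (-e) * (3 * 2 ^ d : ℝ) ^ e := by
            rw [← Real.rpow_add (by positivity)]; simp
        _ ≤ _ := by
            gcongr ?_ * ?_
            exact Real.rpow_le_rpow_of_nonpos hvpos hvs he0
    calc B + g * B = (1 + g) * B * 1 := by ring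
      _ ≤ (1 + g) * B * ((3 * 2 ^ d : ℝ) ^ (-e) * (v:ℝ) ^ e) := by gcongr
      _ = ((1 + g) * (3 * 2 ^ d : ℝ) ^ (-e)) * B * (v:ℝ) ^ e := by ring
      _ ≤ C * B * (v:ℝ) ^ e := by
          gcongr
          have : 0 < C₁ + 2 ^ r * g := by positivity
          linarith
  · obtain ⟨J, hJ1, hJ2⟩ := exists_nat_pow_near (x := (v:ℝ) ^ c) (y := (2:ℝ))
      (Real.one_le_rpow hv1 hc0.le) (by norm_num)
    refine ⟨J, hJ1, ?_⟩
    intro B hB0 μ hμ hB f hf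
    obtain ⟨a, -, hfs, ha⟩ := hf
    obtain ⟨F, cc, hF, hFv, hFe⟩ := hlarge Ω μ ψ hψ B hB0 hB a ha J v hbig
    refine (aux_core μ p hp ψ hψ B hB0 hB β r hβ0 hβ1 hr a f hfs ha J v F cc hF hFv _ hFe).trans ?_
    rw [← hg]
    have hJb : (2:ℝ) ^ (-(r * J)) ≤ 2 ^ r * (v:ℝ) ^ e := by
      have h1 : (2:ℝ) ^ (-(r * J)) = 2 ^ r * ((2:ℝ) ^ (J + 1)) ^ (-r) := by
        rw [← Real.rpow_natCast, ← Real.rpow_mul (by norm_num), ← Real.rpow_add (by norm_num)]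
        congr 1; push_cast; ring
      rw [h1]
      gcongr ?_ * ?_
      calc ((2:ℝ) ^ (J + 1)) ^ (-r) ≤ ((v:ℝ) ^ c) ^ (-r) :=
            Real.rpow_le_rpow_of_nonpos (by positivity) hJ2.le (by linarith)
        _ = (v:ℝ) ^ (-(1 / β + r / d)) := by
            rw [← Real.rpow_mul hvpos.le]; congr 1; rw [hc]; field_simp
        _ ≤ (v:ℝ) ^ e := by
            apply Real.rpow_le_rpow_of_exponent_le hv1
            have : 0 < 1 / min p 2 := by positivity
            rw [he]; linarith
    calc C₁ * B * (v:ℝ) ^ e + (2:ℝ) ^ (-(r * J)) * g * B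
        ≤ C₁ * B * (v:ℝ) ^ e + (2 ^ r * (v:ℝ) ^ e) * g * B := by gcongr
      _ = (C₁ + 2 ^ r * g) * B * (v:ℝ) ^ e := by ring
      _ ≤ C * B * (v:ℝ) ^ e := by
          gcongr
          have : 0 < (1 + g) * (3 * 2 ^ d : ℝ) ^ (-e) := by positivity
          linarith
end
end

section
/- Let Y = {y_j}_{j=1}^N be an orthonormal system in a Hilbert space H. Then for any n < N the Kolmogorov width of the finite set Y satisfies d_n(Y, H) ≥ (1 − n/N)^{1/2}. -/
open MeasureTheory Finset
open scoped ENNReal NNReal BigOperators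

noncomputable section

attribute [local instance] Classical.propDecidable

open SamplingRecovery

lemma kw_exists {H : Type*} [NormedAddCommGroup H] [InnerProductSpace ℂ H]
    (N : ℕ) (y : Fin N → H) (hy : Orthonormal ℂ y) (n : ℕ) (hn : n < N) (u : Fin n → H) :
    ∃ j, ∀ c : Fin n → ℂ, Real.sqrt (1 - (n : ℝ) / N) ≤ ‖y j - ∑ i, c i • u i‖ := by
  classical
  set U := Submodule.span ℂ (Set.range u) with hU
  haveI : FiniteDimensional ℂ U := FiniteDimensional.span_of_finite ℂ (Set.finite_range u)
  have hdim : Module.finrank ℂ U ≤ n := by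
    simpa [Set.finrank, hU] using finrank_range_le_card (R := ℂ) u
  let b := stdOrthonormalBasis ℂ U
  have hN : (0 : ℝ) < N := by exact_mod_cast (Nat.zero_le n).trans_lt hn
  -- key sum bound
  have hsum : ∑ j, ∑ k, ‖inner ℂ (y j) (b k : H)‖ ^ 2 ≤ (n : ℝ) := by
    rw [Finset.sum_comm]
    calc _ ≤ ∑ k, (1 : ℝ) := by
          refine Finset.sum_le_sum fun k _ => ?_
          have h := hy.sum_inner_products_le (b k : H) (s := Finset.univ)
          have h1 : ‖(b k : H)‖ = 1 := b.orthonormal.1 k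
          rw [h1] at h
          simpa using h
      _ ≤ n := by simpa using (by exact_mod_cast hdim : (Module.finrank ℂ U : ℝ) ≤ n)
  obtain ⟨j, hj⟩ : ∃ j, ∑ k, ‖inner ℂ (y j) (b k : H)‖ ^ 2 ≤ (n : ℝ) / N := by
    by_contra! hcon
    have : ∑ j : Fin N, (n : ℝ) / N < ∑ j, ∑ k, ‖inner ℂ (y j) (b k : H)‖ ^ 2 :=
      Finset.sum_lt_sum_of_nonempty ⟨⟨n, hn⟩, Finset.mem_univ _⟩ fun j _ => hcon j
    simp only [Finset.sum_const, Finset.card_univ, Fintype.card_fin, nsmul_eq_mul] at this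
    rw [mul_div_cancel₀ _ hN.ne'] at this
    linarith
  refine ⟨j, fun c => ?_⟩
  have hv : ∑ i, c i • u i ∈ U :=
    Submodule.sum_mem _ fun i _ => U.smul_mem _ (Submodule.subset_span ⟨i, rfl⟩)
  generalize ∑ i, c i • u i = v at hv
  have hPn : ‖U.orthogonalProjectionOnto (y j)‖ ^ 2 ≤ (n : ℝ) / N := by
    rw [← b.sum_sq_norm_inner_right]
    refine le_trans (le_of_eq (Finset.sum_congr rfl fun k _ => ?_)) hj
    rw [norm_inner_symm, Submodule.inner_orthogonalProjectionOnto_eq_of_mem_right]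
  have h1 := U.norm_sq_eq_add_norm_sq_starProjection (y j)
  have h3 : Uᗮ.starProjection (y j) = y j - U.starProjection (y j) := by
    rw [← U.starProjection_add_starProjection_orthogonal (y j)]
    simp
  have h2 : ‖y j - U.starProjection (y j)‖ ≤ ‖y j - v‖ := by
    rw [Submodule.starProjection_minimal]
    exact ciInf_le ⟨0, by rintro _ ⟨x, rfl⟩; exact norm_nonneg _⟩ (⟨v, hv⟩ : U)
  have h4 : ‖U.starProjection (y j)‖ ^ 2 ≤ (n : ℝ) / N := hPn
  rw [hy.1 j, h3] at h1
  refine le_trans (Real.sqrt_le_iff.2 ⟨norm_nonneg _, ?_⟩) h2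
  linarith

/-- Lemma 4.2: if `Y = {y_j}_{j=1}^N` is an orthonormal system in a
Hilbert space `H`, then for any `n < N` the Kolmogorov width of the set `Y` satisfies
`d_n(Y, H) ≥ (1 − n/N)^{1/2}`. -/
theorem kolmogorov_width_orthonormal
    {H : Type*} [NormedAddCommGroup H] [InnerProductSpace ℂ H]
    (N : ℕ) (y : Fin N → H) (hy : Orthonormal ℂ y) (n : ℕ) (hn : n < N) :
    Real.sqrt (1 - (n : ℝ) / N) ≤ kWidth (fun h : H => ‖h‖) (Set.range y) n := by
  unfold kWidth
  refine le_ciInf fun u => ?_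
  obtain ⟨j, hj⟩ := kw_exists N y hy n hn u
  have hbd : BddAbove (Set.range fun f : H => ⨆ _ : f ∈ Set.range y,
      ⨅ c : Fin n → ℂ, ‖f - ∑ i, c i • u i‖) := by
    refine Set.Finite.bddAbove (Set.Finite.subset
      (((Set.finite_range y).image fun f => ⨅ c : Fin n → ℂ, ‖f - ∑ i, c i • u i‖).union
        (Set.finite_singleton 0)) ?_)
    rintro _ ⟨f, rfl⟩
    by_cases hf : f ∈ Set.range y
    · left
      refine ⟨f, hf, ?_⟩
      beta_reduce
      rw [ciSup_pos hf]
    · right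
      simp only [Set.mem_singleton_iff]
      haveI : IsEmpty (f ∈ Set.range y) := ⟨hf⟩
      exact Real.iSup_of_isEmpty _
  refine le_trans ?_ (le_ciSup hbd (y j))
  rw [ciSup_pos (Set.mem_range_self j)]
  exact le_ciInf hj
end
end

section
/- Let 1 ≤ p < ∞ and let m, v, N be natural numbers with 2v ≤ N. Let D_N ⊂ C(Ω) be a system of N continuous functions, and assume there exists a set ξ = {ξ^1,…,ξ^m} ⊂ Ω providing one-sided L_p-universal discretization: ‖f‖_p ≤ D ((1/m) Σ_{j=1}^m |f(ξ^j)|^p)^{1/p} for all f ∈ Σ_{2v}(D_N). Then for any f ∈ C(Ω), every best v-term approximant B_v(f, D_N, L_p(ξ)) of f with respect to D_N in the discrete norm L_p(ξ) satisfies ‖f − B_v(f, D_N, L_p(ξ))‖_{L_p(Ω,μ)} ≤ 2^{1/p}(2D + 1) σ_v(f, D_N)_{L_p(Ω,μ_ξ)} and ‖f − B_v(f, D_N, L_p(ξ))‖_{L_p(Ω,μ)} ≤ (2D + 1) σ_v(f, D_N)_∞, where μ_ξ := (μ + μ_m)/2 = (1/2)μ + (1/(2m)) Σ_{j=1}^m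 δ_{ξ^j}. -/
open MeasureTheory Finset
open scoped ENNReal NNReal BigOperators

noncomputable section

attribute [local instance] Classical.propDecidable

open SamplingRecovery

lemma lpNorm_add_le' {X : Type*} [TopologicalSpace X] [CompactSpace X] [MeasurableSpace X]
    [BorelSpace X] (μ : Measure X) [IsFiniteMeasure μ] (p : ℝ) (hp : 1 ≤ p)
    (u w : X → ℂ) (hu : Continuous u) (hw : Continuous w) :
    lpNorm μ p (u + w) ≤ lpNorm μ p u + lpNorm μ p w := by
  have hp0 : 0 < p := by linarith
  have key : ∀ z : X → ℂ, Continuous z →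
      MemLp z (ENNReal.ofReal p) μ ∧ lpNorm μ p z = (eLpNorm z (ENNReal.ofReal p) μ).toReal := by
    intro z hz
    have hm : MemLp z (ENNReal.ofReal p) μ := by
      obtain ⟨C, hC⟩ := isCompact_univ.exists_bound_of_continuousOn hz.continuousOn
      refine MemLp.of_bound hz.aestronglyMeasurable_of_compactSpace C ?_
      exact Filter.Eventually.of_forall fun x => hC x (Set.mem_univ x)
    refine ⟨hm, ?_⟩
    rw [hm.eLpNorm_eq_integral_rpow_norm (by simpa using hp0) ENNReal.ofReal_ne_top,
      ENNReal.toReal_ofReal hp0.le, ENNReal.toReal_ofReal]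
    · simp [SamplingRecovery.lpNorm]
    · positivity
  obtain ⟨hu1, hu2⟩ := key u hu
  obtain ⟨hw1, hw2⟩ := key w hw
  rw [hu2, hw2, (key (u + w) (hu.add hw)).2,
    ← ENNReal.toReal_add hu1.eLpNorm_ne_top hw1.eLpNorm_ne_top]
  exact ENNReal.toReal_mono (ENNReal.add_ne_top.2 ⟨hu1.eLpNorm_ne_top, hw1.eLpNorm_ne_top⟩)
    (eLpNorm_add_le hu1.1 hw1.1 (by simpa using hp))

lemma dNorm_add_le' {X : Type*} {m : ℕ} (ξ : Fin m → X) (p : ℝ) (hp : 1 ≤ p)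
    (u w : X → ℂ) : dNorm ξ p (u + w) ≤ dNorm ξ p u + dNorm ξ p w := by
  have h := Real.Lp_add_le (Finset.univ : Finset (Fin m)) (fun j => ‖u (ξ j)‖)
    (fun j => ‖w (ξ j)‖) hp
  simp only [abs_norm] at h
  unfold dNorm
  rw [Real.mul_rpow (by positivity) (by positivity), Real.mul_rpow (by positivity) (by positivity),
    Real.mul_rpow (by positivity) (by positivity), ← mul_add]
  refine mul_le_mul_of_nonneg_left (le_trans ?_ h) (by positivity)
  refine Real.rpow_le_rpow (by positivity) (Finset.sum_le_sum fun j _ => ?_) (by positivity)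
  refine Real.rpow_le_rpow (by positivity) ?_ (by positivity)
  exact (norm_add_le _ _).trans (le_abs_self _)

lemma dNorm_sub_comm' {X : Type*} {m : ℕ} (ξ : Fin m → X) (p : ℝ)
    (u w : X → ℂ) : dNorm ξ p (u - w) = dNorm ξ p (w - u) := by
  unfold dNorm
  simp only [Pi.sub_apply, norm_sub_rev]

lemma integral_sampleMeasure' {X : Type*} [TopologicalSpace X] [CompactSpace X]
    [MeasurableSpace X] [BorelSpace X] (μ : Measure X) [IsFiniteMeasure μ] {m : ℕ}
    (ξ : Fin m → X) (F : X → ℝ) (hF : Continuous F) :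
    ∫ x, F x ∂(sampleMeasure μ ξ) =
      (1 / 2) * ∫ x, F x ∂μ + (1 / 2) * ((m : ℝ)⁻¹ * ∑ j, F (ξ j)) := by
  have hint : ∀ ν : Measure X, IsFiniteMeasure ν → Integrable F ν := fun ν _ =>
    hF.integrable_of_hasCompactSupport (HasCompactSupport.of_compactSpace F)
  unfold sampleMeasure
  rcases Nat.eq_zero_or_pos m with rfl | hm
  · simp [integral_smul_measure]
  have hne : ((2 * m : ℝ≥0∞))⁻¹ ≠ ⊤ := by
    simp; omega
  have hd : ∀ j ∈ (Finset.univ : Finset (Fin m)), Integrable F (Measure.dirac (ξ j)) :=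
    fun j _ => hint _ inferInstance
  rw [integral_add_measure ((hint μ inferInstance).smul_measure (by simp))
    ((integrable_finsetSum_measure.2 hd).smul_measure hne),
    integral_smul_measure, integral_smul_measure, integral_finsetSum_measure hd]
  have : ∀ j, ∫ x, F x ∂(Measure.dirac (ξ j)) = F (ξ j) := fun j =>
    integral_dirac' _ _ hF.stronglyMeasurable
  simp only [this]
  simp [mul_assoc, mul_left_comm]

lemma sigmaSet_sub' {X ι : Type*} (g : ι → X → ℂ) (v : ℕ) (a b : X → ℂ)
    (ha : a ∈ SigmaSet g v) (hb : b ∈ SigmaSet g v) : a - b ∈ SigmaSet g (2 * v) := by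
  obtain ⟨A, c, hA, rfl⟩ := ha
  obtain ⟨B, e, hB, rfl⟩ := hb
  refine ⟨A ∪ B, fun i => (if i ∈ A then c i else 0) - (if i ∈ B then e i else 0), ?_, ?_⟩
  · have := Finset.card_union_le A B
    omega
  · funext x
    simp only [Pi.sub_apply, sub_mul, Finset.sum_sub_distrib, ite_mul, zero_mul,
      Finset.sum_ite_mem]
    congr 1
    · rw [Finset.inter_eq_right.2 Finset.subset_union_left]
    · rw [Finset.inter_eq_right.2 Finset.subset_union_right]

/-- Theorem 6.5: if `ξ` provides one-sided `L_p`-universal discretization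
`‖f‖_p ≤ D ((1/m) ∑_j |f(ξ^j)|^p)^{1/p}` for all `f ∈ Σ_{2v}(D_N)`, then for any
`f ∈ C(Ω)` every best `v`-term approximant `b` of `f` with respect to `D_N` in the
discrete norm `L_p(ξ)` satisfies
`‖f − b‖_p ≤ 2^{1/p}(2D+1) σ_v(f,D_N)_{L_p(Ω,μ_ξ)}` and
`‖f − b‖_p ≤ (2D+1) σ_v(f,D_N)_∞`, where `μ_ξ = (μ + μ_m)/2`. -/
theorem best_discrete_approx_recovery
    {d : ℕ} (p : ℝ) (hp : 1 ≤ p)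
    (Ω : Set (Fin d → ℝ)) (hΩ : IsCompact Ω)
    (μ : Measure Ω) (hμ : IsProbabilityMeasure μ)
    (m v N : ℕ) (hvN : 2 * v ≤ N)
    (g : Fin N → Ω → ℂ) (hg : ∀ i, Continuous (g i))
    (D : ℝ) (hD : 0 < D)
    (ξ : Fin m → Ω)
    (husd : ∀ f ∈ SigmaSet g (2 * v), lpNorm μ p f ≤ D * dNorm ξ p f)
    (f : Ω → ℂ) (hf : Continuous f)
    (b : Ω → ℂ) (hb : b ∈ SigmaSet g v)
    (hbest : ∀ h ∈ SigmaSet g v, dNorm ξ p (f - b) ≤ dNorm ξ p (f - h)) :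
    lpNorm μ p (f - b) ≤
      (2 : ℝ) ^ (1 / p) * (2 * D + 1) *
        sigmaErr (lpNorm (sampleMeasure μ ξ) p) g v f ∧
    lpNorm μ p (f - b) ≤ (2 * D + 1) * sigmaErr supNorm g v f := by
  have hp0 : 0 < p := by linarith
  haveI : CompactSpace Ω := isCompact_iff_compactSpace.1 hΩ
  have hcont : ∀ h ∈ SigmaSet g v, Continuous h := by
    rintro h ⟨B, c, -, rfl⟩
    exact continuous_finsetSum _ fun i _ => continuous_const.mul (hg i)
  have main : ∀ h ∈ SigmaSet g v,
      lpNorm μ p (f - b) ≤ lpNorm μ p (f - h) + 2 * D * dNorm ξ p (f - h) := by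
    intro h hh
    have h1 := lpNorm_add_le' μ p hp (f - h) (h - b) (hf.sub (hcont h hh))
      ((hcont h hh).sub (hcont b hb))
    have h2 := husd _ (sigmaSet_sub' g v h b hh hb)
    have h3 := dNorm_add_le' ξ p hp (h - f) (f - b)
    rw [sub_add_sub_cancel] at h1 h3
    rw [dNorm_sub_comm' ξ p h f] at h3
    have h4 := hbest h hh
    have h5 : D * dNorm ξ p (h - b) ≤ D * (2 * dNorm ξ p (f - h)) :=
      mul_le_mul_of_nonneg_left (by linarith) hD.le
    linarith
  have hne : (SigmaSet g v).Nonempty := ⟨b, hb⟩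
  constructor
  · rw [← div_le_iff₀' (by positivity)]
    refine le_csInf (hne.image _) ?_
    rintro _ ⟨h, hh, rfl⟩
    rw [div_le_iff₀' (by positivity)]
    have hm := main h hh
    have hI := integral_sampleMeasure' μ ξ (fun x => ‖(f - h) x‖ ^ p)
      (((hf.sub (hcont h hh)).norm).rpow_const fun _ => Or.inr hp0.le)
    have e : (2 : ℝ) ^ (1 / p) * lpNorm (sampleMeasure μ ξ) p (f - h) =
        ((∫ x, ‖(f - h) x‖ ^ p ∂μ) + (m : ℝ)⁻¹ * ∑ j, ‖(f - h) (ξ j)‖ ^ p) ^ (1 / p) := by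
      unfold SamplingRecovery.lpNorm
      rw [← Real.mul_rpow (by norm_num) (by positivity), hI]
      congr 1
      ring
    have hd0 : 0 ≤ (m : ℝ)⁻¹ * ∑ j, ‖(f - h) (ξ j)‖ ^ p := by positivity
    have hi0 : 0 ≤ ∫ x, ‖(f - h) x‖ ^ p ∂μ := by positivity
    have a1 : lpNorm μ p (f - h) ≤ 2 ^ (1 / p) * lpNorm (sampleMeasure μ ξ) p (f - h) := by
      rw [e]
      exact Real.rpow_le_rpow hi0 (by linarith) (by positivity)
    have a2 : dNorm ξ p (f - h) ≤ 2 ^ (1 / p) * lpNorm (sampleMeasure μ ξ) p (f - h) := by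
      rw [e]
      exact Real.rpow_le_rpow hd0 (by linarith) (by positivity)
    have a3 := mul_le_mul_of_nonneg_left a2 (by positivity : 0 ≤ 2 * D)
    show lpNorm μ p (f - b) ≤ 2 ^ (1 / p) * (2 * D + 1) * lpNorm (sampleMeasure μ ξ) p (f - h)
    linarith
  · rw [← div_le_iff₀' (by positivity)]
    refine le_csInf (hne.image _) ?_
    rintro _ ⟨h, hh, rfl⟩
    rw [div_le_iff₀' (by positivity)]
    have hm := main h hh
    have hc : Continuous (f - h) := hf.sub (hcont h hh)
    have hle : ∀ x, ‖(f - h) x‖ ≤ supNorm (f - h) := by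
      intro x
      refine le_ciSup (f := fun x => ‖(f - h) x‖) ?_ x
      exact (isCompact_range hc.norm).bddAbove
    have hs0 : 0 ≤ supNorm (f - h) := Real.iSup_nonneg fun x => norm_nonneg _
    have hroot : (supNorm (f - h) ^ p) ^ (1 / p) = supNorm (f - h) := by
      rw [one_div, Real.rpow_rpow_inv hs0 hp0.ne']
    have hpt : ∀ x, ‖(f - h) x‖ ^ p ≤ supNorm (f - h) ^ p := fun x =>
      Real.rpow_le_rpow (norm_nonneg _) (hle x) hp0.le
    have a1 : lpNorm μ p (f - h) ≤ supNorm (f - h) := by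
      refine le_trans (Real.rpow_le_rpow (by positivity) ?_ (by positivity)) hroot.le
      have hcp : Continuous fun x => ‖(f - h) x‖ ^ p :=
        hc.norm.rpow_const fun _ => Or.inr hp0.le
      have := integral_mono (μ := μ)
        (hcp.integrable_of_hasCompactSupport (HasCompactSupport.of_compactSpace _))
        (integrable_const _) hpt
      simpa using this
    have a2 : dNorm ξ p (f - h) ≤ supNorm (f - h) := by
      refine le_trans (Real.rpow_le_rpow (by positivity) ?_ (by positivity)) hroot.le
      have hsum : ∑ j, ‖(f - h) (ξ j)‖ ^ p ≤ m * supNorm (f - h) ^ p := by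
        simpa using Finset.sum_le_sum (s := Finset.univ) fun (j : Fin m) _ => hpt (ξ j)
      rcases Nat.eq_zero_or_pos m with h0 | h0
      · subst h0
        simp only [Nat.cast_zero, inv_zero, zero_mul]
        positivity
      · rw [inv_mul_le_iff₀ (by exact_mod_cast h0)]
        exact hsum
    have a3 := mul_le_mul_of_nonneg_left a2 (by positivity : 0 ≤ 2 * D)
    show lpNorm μ p (f - b) ≤ (2 * D + 1) * supNorm (f - h)
    linarith
end
end
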